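/- Necessity part of the scaling theorem for the additive kernel: Let ν₀ be a positive Radon measure on (0,∞) with ∫ x ν₀(dx) = 1, let (ν_t)_{t≥0} be the solution of Smoluchowski's coagulation equation with kernel K=x+y and initial data ν₀, and set M(t,x) = ∫₀^x y ν_t(dy) (a probability distribution function in x for each t). Suppose there is a function λ(t) → ∞ as t → ∞ and a nontrivial probability distribution function M_* (nondecreasing, right-continuous, lim_{x→∞} M_*(x) = 1, and M_*(x) < 1 for some x > 0) such that lim_{t→∞} M(t, λ(t)x) = M_*(x) at every point of continuity of M_*. Then there exist ρ ∈ (0,1] and a function L slowly varying at infinity such that ∫₀^x y² ν₀(dy) ~ x^{1−ρ} L(x) as x → ∞. -/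

import Mathlib

/-!
Necessity part of the scaling theorem for Smoluchowski's coagulation equation
with additive kernel K = x + y.
-/

open MeasureTheory Filter Topology Set Real

noncomputable section

def kap (z : ℝ) : ℝ := 1 - Real.exp (-z) - z * Real.exp (-z)

lemma kap_cont : Continuous kap := by unfold kap; fun_prop

lemma kap_hasDeriv (z : ℝ) : HasDerivAt kap (z * Real.exp (-z)) z := by
  have h1 : HasDerivAt (fun z : ℝ => Real.exp (-z)) (Real.exp (-z) * (-1)) z :=
    (hasDerivAt_neg z).exp
  have h := ((hasDerivAt_const z (1:ℝ)).sub h1).sub ((hasDerivAt_id z).mul h1)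
  refine HasDerivAt.congr_deriv (f := kap) h ?_
  simp

lemma kap_strictMono : StrictMonoOn kap (Ici 0) := by
  apply strictMonoOn_of_deriv_pos (convex_Ici 0) kap_cont.continuousOn
  intro x hx
  rw [interior_Ici] at hx
  rw [(kap_hasDeriv x).deriv]
  exact mul_pos hx (Real.exp_pos _)

lemma kap_zero : kap 0 = 0 := by simp [kap]

lemma kap_pos {z : ℝ} (hz : 0 < z) : 0 < kap z := by
  have := kap_strictMono (mem_Ici.2 le_rfl) (mem_Ici.2 hz.le) hz
  rwa [kap_zero] at this

lemma kap_nonneg {z : ℝ} (hz : 0 ≤ z) : 0 ≤ kap z := by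
  have := kap_strictMono.monotoneOn (mem_Ici.2 le_rfl) (mem_Ici.2 hz) hz
  rwa [kap_zero] at this

lemma kap_le_sq {z : ℝ} (hz : 0 ≤ z) : kap z ≤ z ^ 2 := by
  have h := Real.add_one_le_exp (-z)
  unfold kap
  nlinarith

lemma kap_antideriv {s y : ℝ} (hy : 0 < y) :
    HasDerivAt (fun y : ℝ => - ((1 - Real.exp (-(s * y))) / y)) (kap (s * y) / y ^ 2) y := by
  have h0 : HasDerivAt (fun y : ℝ => -(s * y)) (-(s * 1)) y := ((hasDerivAt_id y).const_mul s).neg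
  have h1 := h0.exp
  have h2 := ((h1.const_sub 1).div (hasDerivAt_id y) hy.ne').neg
  refine HasDerivAt.congr_deriv h2 ?_
  simp [kap]
  field_simp
  ring

lemma kap_lim {s : ℝ} (hs : 0 < s) :
    Tendsto (fun y : ℝ => - ((1 - Real.exp (-(s * y))) / y)) atTop (𝓝 0) := by
  have h1 : Tendsto (fun y : ℝ => 1 - Real.exp (-(s * y))) atTop (𝓝 (1 - 0)) := by
    apply Tendsto.const_sub
    exact Real.tendsto_exp_neg_atTop_nhds_zero.comp (tendsto_id.const_mul_atTop hs)
  have h2 := (h1.mul tendsto_inv_atTop_zero).neg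
  simpa [div_eq_mul_inv] using h2

lemma kap_nn {s y : ℝ} (hs : 0 < s) (hy : 0 < y) : 0 ≤ kap (s * y) / y ^ 2 :=
  div_nonneg (kap_nonneg (mul_pos hs hy).le) (sq_nonneg _)

lemma kap_intOn {s x : ℝ} (hs : 0 < s) (hx : 0 < x) :
    IntegrableOn (fun y => kap (s * y) / y ^ 2) (Ioi x) :=
  integrableOn_Ioi_deriv_of_nonneg' (fun y hy => kap_antideriv (hx.trans_le hy))
    (fun y hy => kap_nn hs (hx.trans hy)) (kap_lim hs)

lemma kap_integral {s x : ℝ} (hs : 0 < s) (hx : 0 < x) :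
    ∫ y in Ioi x, kap (s * y) / y ^ 2 = (1 - Real.exp (-(s * x))) / x := by
  rw [integral_Ioi_of_hasDerivAt_of_nonneg' (fun y hy => kap_antideriv (hx.trans_le hy))
    (fun y hy => kap_nn hs (hx.trans hy)) (kap_lim hs)]
  simp

lemma kap_meas (s : ℝ) : Measurable (fun y => kap (s * y) / y ^ 2) := by
  have := kap_cont.measurable
  fun_prop

lemma kap_int {s : ℝ} (hs : 0 < s) :
    IntegrableOn (fun y => kap (s * y) / y ^ 2) (Ioi 0) := by
  rw [← Ioc_union_Ioi_eq_Ioi zero_le_one]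
  refine IntegrableOn.union ?_ (kap_intOn hs one_pos)
  refine Measure.integrableOn_of_bounded (M := s ^ 2) (by simp)
    (kap_meas s).aestronglyMeasurable ?_
  refine (ae_restrict_iff' measurableSet_Ioc).2 (Eventually.of_forall ?_)
  intro y hy
  rw [Real.norm_of_nonneg (kap_nn hs hy.1), div_le_iff₀ (pow_pos hy.1 2)]
  have := kap_le_sq (mul_pos hs hy.1).le
  linarith [mul_pow s y 2]

lemma kap_mul_int {s : ℝ} (hs : 0 < s) {F : ℝ → ℝ} (hF : Measurable F)
    (hF0 : ∀ y, 0 < y → 0 ≤ F y) (hF1 : ∀ y, 0 < y → F y ≤ 1) :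
    IntegrableOn (fun y => kap (s * y) / y ^ 2 * F y) (Ioi 0) := by
  refine Integrable.mono' (kap_int hs) ((kap_meas s).mul hF).aestronglyMeasurable ?_
  refine (ae_restrict_iff' measurableSet_Ioi).2 (Eventually.of_forall ?_)
  intro y hy
  rw [Real.norm_of_nonneg (mul_nonneg (kap_nn hs hy) (hF0 y hy))]
  exact mul_le_of_le_one_right (kap_nn hs hy) (hF1 y hy)

lemma strict_int {f g : ℝ → ℝ} (hf : IntegrableOn f (Ioi 0)) (hg : IntegrableOn g (Ioi 0))
    (hle : ∀ y, 0 < y → f y ≤ g y) {p q : ℝ} (hp : 0 ≤ p) (hpq : p < q)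
    (hlt : ∀ y ∈ Ioo p q, f y < g y) :
    ∫ y in Ioi 0, f y < ∫ y in Ioi 0, g y := by
  have h : 0 < ∫ y in Ioi 0, (g y - f y) := by
    rw [setIntegral_pos_iff_support_of_nonneg_ae (f := fun y => g y - f y) _ (hg.sub hf)]
    · have h1 : Ioo p q ⊆ Function.support (fun y => g y - f y) ∩ Ioi 0 := by
        intro y hy
        exact ⟨(sub_pos.2 (hlt y hy)).ne', hp.trans_lt hy.1⟩
      refine lt_of_lt_of_le ?_ (measure_mono h1)
      simp [hpq]
    · refine (ae_restrict_iff' measurableSet_Ioi).2 (Eventually.of_forall ?_)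
      intro y hy
      exact sub_nonneg.2 (hle y hy)
  rw [integral_sub hg hf] at h
  linarith

/-- limit profile -/
def aF (F : ℝ → ℝ) (s : ℝ) : ℝ := ∫ y in Ioi 0, kap (s * y) / y ^ 2 * F y

lemma aF_scale (F : ℝ → ℝ) {s : ℝ} (hs : 0 < s) (r : ℝ) :
    aF F (s * r) = s * aF (fun z => F (z / s)) r := by
  unfold aF
  have h := integral_comp_mul_left_Ioi (fun z => kap (r * z) / z ^ 2 * F (z / s)) 0 hs
  simp only [mul_zero, smul_eq_mul] at h
  have h2 : ∫ z in Ioi 0, kap (r * z) / z ^ 2 * F (z / s)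
      = s * ∫ x in Ioi 0, kap (r * (s * x)) / (s * x) ^ 2 * F (s * x / s) := by
    rw [h]; field_simp
  rw [h2, ← integral_const_mul, ← integral_const_mul]
  refine setIntegral_congr_fun measurableSet_Ioi ?_
  intro y hy
  have hy' : (0:ℝ) < y := hy
  have e : s * y / s = y := by field_simp
  simp only [e]
  rw [show r * (s * y) = s * r * y by ring]
  field_simp

lemma aF_strictMono {F : ℝ → ℝ} (hF : Monotone F) (hF0 : ∀ y, 0 ≤ F y)
    (hF1 : Tendsto F atTop (𝓝 1)) {s r : ℝ} (hs : 0 < s) (hsr : s < r) : aF F s < aF F r := by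
  have hle : ∀ y, F y ≤ 1 := fun y => hF.ge_of_tendsto hF1 y
  obtain ⟨p, hp0, hp⟩ : ∃ p : ℝ, 0 < p ∧ 0 < F p :=
    ((eventually_gt_atTop (0:ℝ)).and (hF1.eventually (lt_mem_nhds one_pos))).exists
  refine strict_int (kap_mul_int hs hF.measurable (fun y _ => hF0 y) (fun y _ => hle y))
    (kap_mul_int (hs.trans hsr) hF.measurable (fun y _ => hF0 y) (fun y _ => hle y)) ?_
    hp0.le (lt_add_one p) ?_
  · intro y hy
    refine mul_le_mul_of_nonneg_right ?_ (hF0 y)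
    refine div_le_div_of_nonneg_right ?_ (sq_nonneg _)
    exact kap_strictMono.monotoneOn (mul_pos hs hy).le (mul_pos (hs.trans hsr) hy).le
      (mul_le_mul_of_nonneg_right hsr.le hy.le)
  · intro y hy
    have hy0 : 0 < y := hp0.trans hy.1
    refine mul_lt_mul_of_pos_right ?_ (hp.trans_le (hF hy.1.le))
    refine div_lt_div_of_pos_right ?_ (pow_pos hy0 2)
    exact kap_strictMono (mul_pos hs hy0).le (mul_pos (hs.trans hsr) hy0).le
      (mul_lt_mul_of_pos_right hsr hy0)

lemma aF_pos {F : ℝ → ℝ} (hF : Monotone F) (hF0 : ∀ y, 0 ≤ F y)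
    (hF1 : Tendsto F atTop (𝓝 1)) {s : ℝ} (hs : 0 < s) : 0 < aF F s := by
  have h := aF_strictMono hF hF0 hF1 (half_pos hs) (half_lt_self hs)
  refine lt_of_le_of_lt ?_ h
  refine setIntegral_nonneg measurableSet_Ioi ?_
  intro y hy
  exact mul_nonneg (kap_nn (half_pos hs) hy) (hF0 y)

lemma aF_div_strictAnti {F : ℝ → ℝ} (hF : Monotone F) (hF0 : ∀ y, 0 ≤ F y)
    (hrc : ∀ x : ℝ, ContinuousWithinAt F (Set.Ici x) x)
    (hF1 : Tendsto F atTop (𝓝 1)) (hnt : ∃ x : ℝ, 0 < x ∧ F x < 1)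
    {s r : ℝ} (hs : 0 < s) (hsr : s < r) : aF F r / r < aF F s / s := by
  have hr : 0 < r := hs.trans hsr
  have hle : ∀ y, F y ≤ 1 := fun y => hF.ge_of_tendsto hF1 y
  have e1 := aF_scale F hs 1
  have e2 := aF_scale F hr 1
  rw [mul_one] at e1 e2
  rw [e1, e2, mul_div_cancel_left₀ _ hs.ne', mul_div_cancel_left₀ _ hr.ne']
  -- a point of strict increase
  obtain ⟨x, hx0, hx⟩ : ∃ x : ℝ, 0 < x ∧ F (x / r) < F (x / s) := by
    by_contra! hcon
    obtain ⟨x0, hx0, hx1⟩ := hnt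
    have key : ∀ n : ℕ, F (x0 * (r / s) ^ n) ≤ F x0 := by
      intro n
      induction n with
      | zero => simp
      | succ n ih =>
        have := hcon (r * (x0 * (r / s) ^ n)) (by positivity)
        rw [mul_div_cancel_left₀ _ hr.ne'] at this
        refine le_trans ?_ (this.trans ih)
        apply le_of_eq; congr 1; rw [pow_succ]; field_simp
    have hlim : Tendsto (fun n : ℕ => F (x0 * (r / s) ^ n)) atTop (𝓝 1) := by
      refine hF1.comp (Tendsto.const_mul_atTop hx0 ?_)
      exact tendsto_pow_atTop_atTop_of_one_lt ((one_lt_div hs).2 hsr)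
    have := le_of_tendsto' hlim key
    linarith
  obtain ⟨δ, hδ, hδ2⟩ : ∃ δ : ℝ, 0 < δ ∧ ∀ y, x / r ≤ y → y < x / r + δ → F y < F (x / s) := by
    have h := (hrc (x / r)).eventually (gt_mem_nhds hx)
    rw [eventually_nhdsWithin_iff, Metric.eventually_nhds_iff] at h
    obtain ⟨δ, hδ, h⟩ := h
    refine ⟨δ, hδ, fun y hy1 hy2 => h ?_ hy1⟩
    rw [Real.dist_eq, abs_of_nonneg (by linarith)]; linarith
  have hm : ∀ c : ℝ, 0 < c → Measurable fun z => F (z / c) := fun c hc =>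
    hF.measurable.comp (measurable_id.div_const c)
  refine strict_int (kap_mul_int one_pos (hm r hr) (fun y _ => hF0 _) (fun y _ => hle _))
    (kap_mul_int one_pos (hm s hs) (fun y _ => hF0 _) (fun y _ => hle _)) ?_
    hx0.le (q := x + δ * r) (by nlinarith [mul_pos hδ hr]) ?_
  · intro y hy
    refine mul_le_mul_of_nonneg_left (hF ?_) (kap_nn one_pos hy)
    exact div_le_div_of_nonneg_left hy.le hs hsr.le
  · intro y hy
    have hy0 : 0 < y := hx0.trans hy.1
    refine mul_lt_mul_of_pos_left ?_ (div_pos (kap_pos (by linarith)) (pow_pos hy0 2))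
    refine lt_of_lt_of_le (hδ2 (y / r) ?_ ?_) (hF ?_)
    · exact div_le_div_of_nonneg_right hy.1.le hr.le
    · rw [div_lt_iff₀ hr, add_mul, div_mul_cancel₀ _ hr.ne']; exact hy.2
    · exact div_le_div_of_nonneg_right hy.1.le hs.le

lemma mass_le {ν : Measure ℝ}
    (hintg : ∀ s : ℝ, 0 < s → Integrable (fun x => 1 - Real.exp (-(s * x))) ν)
    (hsupp : ν (Iic 0) = 0)
    (hle : ∀ s : ℝ, 0 < s → ∫ x, (1 - Real.exp (-(s * x))) ∂ν ≤ s) :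
    ∫⁻ x, ENNReal.ofReal x ∂ν ≤ 1 := by
  have hpos : ∀ᵐ x ∂ν, 0 < x := by
    rw [ae_iff]; simpa [Iic] using hsupp
  let f : ℕ → ℝ → ENNReal := fun n x =>
    ENNReal.ofReal (((n:ℝ) + 1) * (1 - Real.exp (-(1 / ((n:ℝ) + 1) * x))))
  have hf : ∀ n, Measurable (f n) := fun n => by fun_prop
  have hlim : ∀ x, Tendsto (fun n => f n x) atTop (𝓝 (ENNReal.ofReal x)) := by
    intro x
    refine (ENNReal.continuous_ofReal.tendsto x).comp ?_
    have hd : HasDerivAt (fun u : ℝ => 1 - Real.exp (-(u * x))) x 0 := by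
      have h0 : HasDerivAt (fun u : ℝ => -(u * x)) (-(1 * x)) 0 :=
        ((hasDerivAt_id (0:ℝ)).mul_const x).neg
      have := h0.exp.const_sub 1
      simpa using this
    have h2 := hd.tendsto_slope_zero_right
    have h3 : Tendsto (fun n : ℕ => 1 / ((n:ℝ) + 1)) atTop (𝓝[>] 0) := by
      refine tendsto_nhdsWithin_iff.2 ⟨tendsto_one_div_add_atTop_nhds_zero_nat, ?_⟩
      exact Eventually.of_forall fun n => by simp only [mem_Ioi]; positivity
    have h4 := h2.comp h3
    refine h4.congr fun n => ?_
    simp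
  have h := lintegral_liminf_le (μ := ν) (u := atTop) hf
  have e : ∀ x, liminf (fun n => f n x) atTop = ENNReal.ofReal x := fun x => (hlim x).liminf_eq
  simp only [e] at h
  refine h.trans ?_
  refine (liminf_le_liminf (v := fun _ : ℕ => (1 : ENNReal)) ?_).trans (by simp)
  refine Eventually.of_forall fun n => ?_
  have hs : (0:ℝ) < 1 / ((n:ℝ) + 1) := by positivity
  have hn : (0:ℝ) < (n:ℝ) + 1 := by positivity
  simp only [f]
  rw [← ofReal_integral_eq_lintegral_ofReal ((hintg _ hs).const_mul _), integral_const_mul]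
  · rw [ENNReal.ofReal_le_one]
    calc _ ≤ ((n:ℝ) + 1) * (1 / ((n:ℝ) + 1)) := mul_le_mul_of_nonneg_left (hle _ hs) hn.le
      _ = 1 := by field_simp
  · filter_upwards [hpos] with x hx
    refine mul_nonneg hn.le (sub_nonneg.2 (Real.exp_le_one_iff.2 ?_))
    have := mul_pos hs hx; linarith

lemma setint_facts {ν : Measure ℝ} (hmass : ∫⁻ x, ENNReal.ofReal x ∂ν ≤ 1) (y : ℝ) :
    ENNReal.ofReal (∫ x in Ioc 0 y, x ∂ν) = ∫⁻ x in Ioc 0 y, ENNReal.ofReal x ∂ν ∧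
    0 ≤ ∫ x in Ioc 0 y, x ∂ν ∧ ∫ x in Ioc 0 y, x ∂ν ≤ 1 := by
  have hnn : 0 ≤ᵐ[ν.restrict (Ioc 0 y)] fun x : ℝ => x :=
    (ae_restrict_iff' measurableSet_Ioc).2 (Eventually.of_forall fun x hx => hx.1.le)
  have hle : ∫⁻ x in Ioc 0 y, ENNReal.ofReal x ∂ν ≤ 1 := (setLIntegral_le_lintegral _ _).trans hmass
  have hintg : IntegrableOn (fun x : ℝ => x) (Ioc 0 y) ν := by
    refine ⟨measurable_id.aestronglyMeasurable, ?_⟩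
    rw [hasFiniteIntegral_iff_ofReal hnn]
    exact hle.trans_lt ENNReal.one_lt_top
  have e := ofReal_integral_eq_lintegral_ofReal hintg hnn
  have h0 := integral_nonneg_of_ae hnn
  refine ⟨e, h0, ?_⟩
  rw [← e] at hle
  exact ENNReal.ofReal_le_one.1 hle

lemma laplace_rep {ν : Measure ℝ} (hsupp : ν (Iic 0) = 0)
    (hmass : ∫⁻ x, ENNReal.ofReal x ∂ν ≤ 1) {s : ℝ} (hs : 0 < s) :
    ∫ x, (1 - Real.exp (-(s * x))) ∂ν = aF (fun y => ∫ x in Ioc 0 y, x ∂ν) s := by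
  have hpos : ∀ᵐ x ∂ν, 0 < x := by
    rw [ae_iff]; simpa [Iic] using hsupp
  set m : Measure ℝ := ν.withDensity (fun x => ENNReal.ofReal x) with hm
  have hmeas : Measurable (fun x : ℝ => ENNReal.ofReal x) := by fun_prop
  have : IsFiniteMeasure m := by
    refine ⟨?_⟩
    rw [hm, withDensity_apply _ MeasurableSet.univ, Measure.restrict_univ]
    exact hmass.trans_lt ENNReal.one_lt_top
  have hFmono : Monotone (fun y => ∫ x in Ioc 0 y, x ∂ν) := by
    intro y z hyz
    have h1 := setint_facts hmass y
    have h2 := setint_facts hmass z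
    refine (ENNReal.ofReal_le_ofReal_iff h2.2.1).1 ?_
    rw [h1.1, h2.1]
    exact lintegral_mono_set (Ioc_subset_Ioc_right hyz)
  have hmIic : ∀ y, m (Iic y) = ENNReal.ofReal (∫ x in Ioc 0 y, x ∂ν) := by
    intro y
    rw [(setint_facts hmass y).1, hm, withDensity_apply _ measurableSet_Iic]
    refine setLIntegral_congr ?_
    filter_upwards [hpos] with x hx
    apply propext
    exact ⟨fun h => ⟨hx, h⟩, fun h => h.2⟩
  have hmpos : ∀ᵐ x ∂m, 0 < x := (withDensity_absolutelyContinuous ν _).ae_le hpos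
  unfold aF
  rw [integral_eq_lintegral_of_nonneg_ae, integral_eq_lintegral_of_nonneg_ae]
  rotate_left
  · refine (ae_restrict_iff' measurableSet_Ioi).2 (Eventually.of_forall fun y hy => ?_)
    exact mul_nonneg (kap_nn hs hy) (setint_facts hmass y).2.1
  · exact ((kap_meas s).mul hFmono.measurable).aestronglyMeasurable
  · filter_upwards [hpos] with x hx
    refine (sub_nonneg.2 (Real.exp_le_one_iff.2 ?_))
    have := mul_pos hs hx; linarith
  · have : Measurable (fun x : ℝ => 1 - Real.exp (-(s * x))) := by fun_prop
    exact this.aestronglyMeasurable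
  congr 1
  have hk : Measurable (fun y => ENNReal.ofReal (kap (s * y) / y ^ 2)) :=
    (kap_meas s).ennreal_ofReal
  calc ∫⁻ x, ENNReal.ofReal (1 - Real.exp (-(s * x))) ∂ν
      = ∫⁻ x, ENNReal.ofReal ((1 - Real.exp (-(s * x))) / x) ∂m := by
        rw [hm, lintegral_withDensity_eq_lintegral_mul _ hmeas (by fun_prop)]
        refine lintegral_congr_ae ?_
        filter_upwards [hpos] with x hx
        simp only [Pi.mul_apply]
        rw [← ENNReal.ofReal_mul hx.le]
        congr 1; field_simp
    _ = ∫⁻ x, (∫⁻ y in Ioi 0, (Ici x).indicator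
          (fun y => ENNReal.ofReal (kap (s * y) / y ^ 2)) y) ∂m := by
        refine lintegral_congr_ae ?_
        filter_upwards [hmpos] with x hx
        rw [← kap_integral hs hx, ofReal_integral_eq_lintegral_ofReal (kap_intOn hs hx)]
        · rw [setLIntegral_indicator measurableSet_Ici]
          refine setLIntegral_congr ?_
          have : Ici x ∩ Ioi 0 = Ici x := inter_eq_left.2 fun y hy => hx.trans_le hy
          rw [this]
          exact Ioi_ae_eq_Ici
        · exact (ae_restrict_iff' measurableSet_Ioi).2 (Eventually.of_forall fun y hy =>
            kap_nn hs (hx.trans hy))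
    _ = ∫⁻ y in Ioi 0, (∫⁻ x, (Ici x).indicator
          (fun y => ENNReal.ofReal (kap (s * y) / y ^ 2)) y ∂m) := by
        refine lintegral_lintegral_swap ?_
        have : (Function.uncurry fun x y => (Ici x).indicator
          (fun y => ENNReal.ofReal (kap (s * y) / y ^ 2)) y) =
          {p : ℝ × ℝ | p.1 ≤ p.2}.indicator
            (fun p => ENNReal.ofReal (kap (s * p.2) / p.2 ^ 2)) := by
          ext p; simp [Function.uncurry, indicator]
        rw [this]
        exact ((hk.comp measurable_snd).indicator
          (measurableSet_le measurable_fst measurable_snd)).aemeasurable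
    _ = ∫⁻ y in Ioi 0, ENNReal.ofReal (kap (s * y) / y ^ 2) * m (Iic y) := by
        refine lintegral_congr fun y => ?_
        have : (fun x => (Ici x).indicator
          (fun y => ENNReal.ofReal (kap (s * y) / y ^ 2)) y) =
          (Iic y).indicator (fun _ => ENNReal.ofReal (kap (s * y) / y ^ 2)) := by
          ext x; simp [indicator]
        rw [this, lintegral_indicator_const measurableSet_Iic]
    _ = _ := by
        refine setLIntegral_congr_fun measurableSet_Ioi fun y hy => ?_
        simp only
        rw [hmIic, ENNReal.ofReal_mul (kap_nn hs hy)]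

lemma tendsto_mul_pos {v : ℝ} (hv : 0 < v) :
    Tendsto (fun s : ℝ => s * v) (𝓝[>] 0) (𝓝[>] 0) := by
  refine tendsto_nhdsWithin_iff.2 ⟨?_, ?_⟩
  · have : Tendsto (fun s : ℝ => s * v) (𝓝 0) (𝓝 (0 * v)) := tendsto_id.mul_const v
    rw [zero_mul] at this
    exact this.mono_left nhdsWithin_le_nhds
  · filter_upwards [self_mem_nhdsWithin] with s hs
    exact mul_pos hs hv

lemma rv_mul {h : ℝ → ℝ} (hpos : ∀ s, 0 < s → 0 < h s) {v w k l : ℝ} (hv : 0 < v)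
    (h1 : Tendsto (fun s => h (s * v) / h s) (𝓝[>] 0) (𝓝 k))
    (h2 : Tendsto (fun s => h (s * w) / h s) (𝓝[>] 0) (𝓝 l)) :
    Tendsto (fun s => h (s * (v * w)) / h s) (𝓝[>] 0) (𝓝 (k * l)) := by
  have h3 := h1.mul (h2.comp (tendsto_mul_pos hv))
  refine h3.congr' ?_
  filter_upwards [self_mem_nhdsWithin] with s hs
  have e1 := (hpos s hs).ne'
  have e2 := (hpos (s * v) (mul_pos hs hv)).ne'
  simp only [Function.comp]
  rw [mul_assoc]
  field_simp

lemma rv_local {h : ℝ → ℝ} (hpos : ∀ s, 0 < s → 0 < h s)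
    (hmono : ∀ s r, 0 < s → s ≤ r → h s ≤ h r)
    (h0 : Tendsto h (𝓝[>] 0) (𝓝 0))
    {a b : ℝ → ℝ} (ha : StrictMonoOn a (Ioi 0)) (hac : ContinuousOn a (Ioi 0))
    (hb : StrictMonoOn b (Ioi 0)) (hbc : ContinuousOn b (Ioi 0))
    (hbpos : ∀ s, 0 < s → 0 < b s)
    {sg : ℝ → ℝ → ℝ} {mu : ℝ → ℝ} (hsg : ∀ᶠ t in atTop, ∀ r, 0 < r → 0 < sg t r)
    (hmu : ∀ᶠ t in atTop, 0 < mu t)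
    (h1 : ∀ r, 0 < r → Tendsto (fun t => sg t r / mu t) atTop (𝓝 (a r)))
    (h2 : ∀ r, 0 < r → Tendsto (fun t => Real.exp t * h (sg t r)) atTop (𝓝 (b r)))
    {v r : ℝ} (hv : 0 < v) (hr : 0 < r) (hvr : a 1 * v = a r) :
    Tendsto (fun s => h (s * v) / h s) (𝓝[>] 0) (𝓝 (b r / b 1)) := by
  have hb1 := hbpos 1 one_pos
  set T : ℝ → ℝ := fun s => Real.log (b 1 / h s) with hT
  have hTexp : ∀ s, 0 < s → Real.exp (T s) * h s = b 1 := by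
    intro s hs
    have := hpos s hs
    simp only [hT]
    rw [Real.exp_log (div_pos hb1 this)]
    field_simp
  have hTlim : Tendsto T (𝓝[>] 0) atTop := by
    refine Real.tendsto_log_atTop.comp ?_
    simp only [div_eq_mul_inv]
    refine Tendsto.const_mul_atTop hb1 ?_
    refine Tendsto.inv_tendsto_nhdsGT_zero ?_
    refine tendsto_nhdsWithin_iff.2 ⟨h0, ?_⟩
    filter_upwards [self_mem_nhdsWithin] with s hs using hpos s hs
  have H1 := fun r hr => (h1 r hr).comp hTlim
  have H2 := fun r hr => (h2 r hr).comp hTlim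
  have hsg' := hTlim.eventually hsg
  have hmu' := hTlim.eventually hmu
  -- one-sided neighbours
  have left : ∀ (f : ℝ → ℝ), ContinuousOn f (Ioi 0) → ∀ x c, 0 < x → c < f x →
      ∃ y, 0 < y ∧ y < x ∧ c < f y := by
    intro f hf x c hx hc
    have hcx : ContinuousAt f x := hf.continuousAt (Ioi_mem_nhds hx)
    have e1 : ∀ᶠ y in 𝓝[<] x, c < f y := (hcx.eventually (lt_mem_nhds hc)).filter_mono
      nhdsWithin_le_nhds
    have e2 : ∀ᶠ y in 𝓝[<] x, 0 < y := (lt_mem_nhds hx : ∀ᶠ y in 𝓝 x, 0 < y).filter_mono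
      nhdsWithin_le_nhds
    have e3 : ∀ᶠ y in 𝓝[<] x, y < x := self_mem_nhdsWithin
    obtain ⟨y, hy⟩ := (e1.and (e2.and e3)).exists
    exact ⟨y, hy.2.1, hy.2.2, hy.1⟩
  have right : ∀ (f : ℝ → ℝ), ContinuousOn f (Ioi 0) → ∀ x c, 0 < x → f x < c →
      ∃ y, x < y ∧ f y < c := by
    intro f hf x c hx hc
    have hcx : ContinuousAt f x := hf.continuousAt (Ioi_mem_nhds hx)
    have e1 : ∀ᶠ y in 𝓝[>] x, f y < c := (hcx.eventually (gt_mem_nhds hc)).filter_mono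
      nhdsWithin_le_nhds
    have e3 : ∀ᶠ y in 𝓝[>] x, x < y := self_mem_nhdsWithin
    obtain ⟨y, hy⟩ := (e1.and e3).exists
    exact ⟨y, hy.2, hy.1⟩
  have A : Tendsto (fun s => s / mu (T s)) (𝓝[>] 0) (𝓝 (a 1)) := by
    refine tendsto_order.2 ⟨fun c hc => ?_, fun c hc => ?_⟩
    · obtain ⟨y, hy0, hy1, hyc⟩ := left a hac 1 c one_pos hc
      have hby : b y < b 1 := hb hy0 (mem_Ioi.2 one_pos) hy1
      filter_upwards [self_mem_nhdsWithin, hsg', hmu',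
        (H1 y hy0).eventually (lt_mem_nhds hyc), (H2 y hy0).eventually (gt_mem_nhds hby)]
        with s hs g1 g2 g3 g4
      simp only [Function.comp] at g3 g4
      refine g3.trans (div_lt_div_of_pos_right ?_ g2)
      by_contra! hcon
      have := hmono _ _ hs hcon
      have := mul_le_mul_of_nonneg_left this (Real.exp_pos (T s)).le
      rw [hTexp s hs] at this
      linarith
    · obtain ⟨y, hy1, hyc⟩ := right a hac 1 c one_pos hc
      have hy0 : 0 < y := one_pos.trans hy1
      have hby : b 1 < b y := hb (mem_Ioi.2 one_pos) hy0 hy1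
      filter_upwards [self_mem_nhdsWithin, hsg', hmu',
        (H1 y hy0).eventually (gt_mem_nhds hyc), (H2 y hy0).eventually (lt_mem_nhds hby)]
        with s hs g1 g2 g3 g4
      simp only [Function.comp] at g3 g4
      refine (div_lt_div_of_pos_right ?_ g2).trans g3
      by_contra! hcon
      have := hmono _ _ (g1 y hy0) hcon
      have := mul_le_mul_of_nonneg_left this (Real.exp_pos (T s)).le
      rw [hTexp s hs] at this
      linarith
  have A2 : Tendsto (fun s => s * v / mu (T s)) (𝓝[>] 0) (𝓝 (a r)) := by
    rw [← hvr]
    refine (A.mul_const v).congr fun s => ?_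
    ring
  have B : Tendsto (fun s => Real.exp (T s) * h (s * v)) (𝓝[>] 0) (𝓝 (b r)) := by
    refine tendsto_order.2 ⟨fun c hc => ?_, fun c hc => ?_⟩
    · obtain ⟨y, hy0, hy1, hyc⟩ := left b hbc r c hr hc
      have hay : a y < a r := ha hy0 hr hy1
      obtain ⟨d, hd1, hd2⟩ := exists_between hay
      filter_upwards [self_mem_nhdsWithin, hsg', hmu',
        (H1 y hy0).eventually (gt_mem_nhds hd1), A2.eventually (lt_mem_nhds hd2),
        (H2 y hy0).eventually (lt_mem_nhds hyc)]
        with s hs g1 g2 g3 g4 g5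
      simp only [Function.comp] at g3 g4 g5
      have : sg (T s) y < s * v := (div_lt_div_iff_of_pos_right g2).1 (g3.trans g4)
      exact g5.trans_le (mul_le_mul_of_nonneg_left (hmono _ _ (g1 y hy0) this.le)
        (Real.exp_pos _).le)
    · obtain ⟨y, hy1, hyc⟩ := right b hbc r c hr hc
      have hy0 : 0 < y := hr.trans hy1
      have hay : a r < a y := ha hr hy0 hy1
      obtain ⟨d, hd1, hd2⟩ := exists_between hay
      filter_upwards [self_mem_nhdsWithin, hsg', hmu',
        (H1 y hy0).eventually (lt_mem_nhds hd2), A2.eventually (gt_mem_nhds hd1),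
        (H2 y hy0).eventually (gt_mem_nhds hyc)]
        with s hs g1 g2 g3 g4 g5
      simp only [Function.comp] at g3 g4 g5
      have : s * v < sg (T s) y := (div_lt_div_iff_of_pos_right g2).1 (g4.trans g3)
      exact (mul_le_mul_of_nonneg_left (hmono _ _ (mul_pos hs hv) this.le)
        (Real.exp_pos _).le).trans_lt g5
  refine (B.div_const (b 1)).congr' ?_
  filter_upwards [self_mem_nhdsWithin] with s hs
  rw [← hTexp s hs, mul_div_mul_left _ _ (Real.exp_pos _).ne']

lemma rv_of_local {h : ℝ → ℝ} (hpos : ∀ s, 0 < s → 0 < h s)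
    (hmono : ∀ s r, 0 < s → s ≤ r → h s ≤ h r)
    (hanti : ∀ s r, 0 < s → s ≤ r → h r / r ≤ h s / s)
    {α β : ℝ} (hα : α < 1) (hβ : 1 < β)
    (hex : ∀ v, 0 < v → α ≤ v → v ≤ β → ∃ k, Tendsto (fun s => h (s * v) / h s) (𝓝[>] 0) (𝓝 k))
    {kβ : ℝ} (hkβ : Tendsto (fun s => h (s * β) / h s) (𝓝[>] 0) (𝓝 kβ)) (hkβ1 : 1 < kβ) :
    ∃ ρ ∈ Ioc (0:ℝ) 1, ∀ v, 0 < v →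
      Tendsto (fun s => h (s * v) / h s) (𝓝[>] 0) (𝓝 (v ^ ρ)) := by
  have hex2 : ∀ v, 0 < v → ∃ k, Tendsto (fun s => h (s * v) / h s) (𝓝[>] 0) (𝓝 k) := by
    intro v hv
    have hl : Tendsto (fun n : ℕ => v ^ (1 / ((n:ℝ) + 1))) atTop (𝓝 1) := by
      have := tendsto_one_div_add_atTop_nhds_zero_nat (𝕜 := ℝ)
      have h2 := (tendsto_const_nhds (x := v)).rpow this (Or.inl hv.ne')
      simpa using h2
    obtain ⟨n, hn1, hn2⟩ := ((hl.eventually (lt_mem_nhds hα)).and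
      (hl.eventually (gt_mem_nhds hβ))).exists
    set w := v ^ (1 / ((n:ℝ) + 1)) with hw
    have hw0 : 0 < w := Real.rpow_pos_of_pos hv _
    obtain ⟨k, hk⟩ := hex w hw0 hn1.le hn2.le
    have key : ∀ m : ℕ, Tendsto (fun s => h (s * w ^ m) / h s) (𝓝[>] 0) (𝓝 (k ^ m)) := by
      intro m
      induction m with
      | zero =>
        simp only [pow_zero, mul_one]
        refine tendsto_const_nhds.congr' ?_
        filter_upwards [self_mem_nhdsWithin] with s hs
        rw [div_self (hpos s hs).ne']
      | succ m ih =>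
        rw [pow_succ, pow_succ]
        exact rv_mul hpos (pow_pos hw0 m) ih hk
    have e : w ^ (n + 1) = v := by
      rw [hw, ← Real.rpow_natCast, ← Real.rpow_mul hv.le]
      push_cast
      rw [one_div_mul_cancel (by positivity), Real.rpow_one]
    have hfin := key (n + 1)
    rw [e] at hfin
    exact ⟨_, hfin⟩
  choose! k hk using hex2
  have kmul : ∀ v w, 0 < v → 0 < w → k (v * w) = k v * k w := fun v w hv hw =>
    tendsto_nhds_unique (hk _ (mul_pos hv hw)) (rv_mul hpos hv (hk v hv) (hk w hw))
  have k1 : ∀ v, 1 ≤ v → 1 ≤ k v := by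
    intro v hv
    refine ge_of_tendsto (hk v (by linarith)) ?_
    filter_upwards [self_mem_nhdsWithin] with s hs
    have hs' : (0:ℝ) < s := hs
    rw [one_le_div (hpos s hs)]
    exact hmono _ _ hs (by nlinarith)
  have k2 : ∀ v, 1 ≤ v → k v ≤ v := by
    intro v hv
    refine le_of_tendsto (hk v (by linarith)) ?_
    filter_upwards [self_mem_nhdsWithin] with s hs
    have hs' : (0:ℝ) < s := hs
    have hv0 : 0 < v := by linarith
    rw [div_le_iff₀ (hpos s hs)]
    have := hanti s (s * v) hs (by nlinarith)
    rw [div_le_div_iff₀ (by positivity) hs'] at this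
    nlinarith
  have kone : k 1 = 1 := le_antisymm (k2 1 le_rfl) (k1 1 le_rfl)
  have kpos : ∀ v, 0 < v → 0 < k v := by
    intro v hv
    rcases le_total 1 v with h1 | h1
    · linarith [k1 v h1]
    · have h2 := k1 v⁻¹ ((one_le_inv₀ hv).2 h1)
      have h3 := kmul v v⁻¹ hv (inv_pos.2 hv)
      rw [mul_inv_cancel₀ hv.ne', kone] at h3
      by_contra! hcon
      nlinarith
  let A : ℝ →+ ℝ := AddMonoidHom.mk' (fun x => Real.log (k (Real.exp x))) (by
    intro x y
    rw [Real.exp_add, kmul _ _ (Real.exp_pos x) (Real.exp_pos y),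
      Real.log_mul (kpos _ (Real.exp_pos x)).ne' (kpos _ (Real.exp_pos y)).ne'])
  have hAdef : ∀ x, A x = Real.log (k (Real.exp x)) := fun x => rfl
  have hA : ∀ x, 0 ≤ x → 0 ≤ A x ∧ A x ≤ x := by
    intro x hx
    have he : 1 ≤ Real.exp x := Real.one_le_exp hx
    refine ⟨Real.log_nonneg (k1 _ he), ?_⟩
    rw [hAdef, Real.log_le_iff_le_exp (kpos _ (Real.exp_pos x))]
    exact k2 _ he
  have hAc : Continuous A := by
    refine AddMonoidHomClass.continuous_of_bound A 1 fun x => ?_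
    rw [one_mul, Real.norm_eq_abs, Real.norm_eq_abs]
    rcases le_total 0 x with h | h
    · rw [abs_of_nonneg h, abs_of_nonneg (hA x h).1]; exact (hA x h).2
    · have h3 := hA (-x) (by linarith)
      rw [map_neg] at h3
      rw [abs_of_nonpos h, abs_of_nonpos (by linarith)]; exact h3.2
  have hlin : ∀ x, A x = x * A 1 := by
    intro x
    have := map_real_smul A hAc x 1
    simpa using this
  have hkv : ∀ v, 0 < v → k v = v ^ (A 1) := by
    intro v hv
    have h1 := hlin (Real.log v)
    rw [hAdef, Real.exp_log hv] at h1
    rw [Real.rpow_def_of_pos hv, ← h1, Real.exp_log (kpos v hv)]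
  refine ⟨A 1, ⟨lt_of_le_of_ne (hA 1 zero_le_one).1 ?_, (hA 1 zero_le_one).2⟩, ?_⟩
  · intro hzero
    have h1 := hkv β (by linarith)
    rw [← hzero, Real.rpow_zero] at h1
    have h2 := tendsto_nhds_unique hkβ (hk β (by linarith))
    linarith
  · intro v hv
    rw [← hkv v hv]
    exact hk v hv

lemma rv_main {h : ℝ → ℝ} (hpos : ∀ s, 0 < s → 0 < h s)
    (hmono : ∀ s r, 0 < s → s ≤ r → h s ≤ h r)
    (hanti : ∀ s r, 0 < s → s ≤ r → h r / r ≤ h s / s)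
    (h0 : Tendsto h (𝓝[>] 0) (𝓝 0))
    {a b : ℝ → ℝ} (ha : StrictMonoOn a (Ioi 0)) (hac : ContinuousOn a (Ioi 0))
    (hapos : ∀ s, 0 < s → 0 < a s)
    (hb : StrictMonoOn b (Ioi 0)) (hbc : ContinuousOn b (Ioi 0))
    (hbpos : ∀ s, 0 < s → 0 < b s)
    {sg : ℝ → ℝ → ℝ} {mu : ℝ → ℝ} (hsg : ∀ᶠ t in atTop, ∀ r, 0 < r → 0 < sg t r)
    (hmu : ∀ᶠ t in atTop, 0 < mu t)
    (h1 : ∀ r, 0 < r → Tendsto (fun t => sg t r / mu t) atTop (𝓝 (a r)))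
    (h2 : ∀ r, 0 < r → Tendsto (fun t => Real.exp t * h (sg t r)) atTop (𝓝 (b r))) :
    ∃ ρ ∈ Ioc (0:ℝ) 1, ∀ v, 0 < v →
      Tendsto (fun s => h (s * v) / h s) (𝓝[>] 0) (𝓝 (v ^ ρ)) := by
  have a1 := hapos 1 one_pos
  have hhalf : (0:ℝ) < 1 / 2 := by norm_num
  have loc := fun {v r : ℝ} => rv_local (v := v) (r := r) hpos hmono h0 ha hac hb hbc hbpos
    hsg hmu h1 h2
  refine rv_of_local hpos hmono hanti (α := a (1 / 2) / a 1) (β := a 2 / a 1)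
    (kβ := b 2 / b 1) ?_ ?_ ?_ ?_ ?_
  · rw [div_lt_one a1]; exact ha (mem_Ioi.2 hhalf) (mem_Ioi.2 one_pos) (by norm_num)
  · rw [one_lt_div a1]; exact ha (mem_Ioi.2 one_pos) (mem_Ioi.2 two_pos) (by norm_num)
  · intro v hv hv1 hv2
    rw [div_le_iff₀ a1] at hv1
    rw [le_div_iff₀ a1] at hv2
    obtain ⟨r, hr, hr2⟩ := intermediate_value_Icc (f := a) (by norm_num : (1/2:ℝ) ≤ 2)
      (hac.mono fun x hx => hhalf.trans_le hx.1) (⟨hv1, hv2⟩ : v * a 1 ∈ Icc _ _)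
    exact ⟨_, loc hv (hhalf.trans_le hr.1) (by rw [hr2]; ring)⟩
  · exact loc (div_pos (hapos 2 two_pos) a1) two_pos (by field_simp)
  · rw [one_lt_div (hbpos 1 one_pos)]; exact hb (mem_Ioi.2 one_pos) (mem_Ioi.2 two_pos) (by norm_num)

lemma poly_moment {ι : Type*} {l : Filter ι} {W : ι → Measure ℝ} {V : Measure ℝ}
    [IsFiniteMeasure V] (hW : ∀ᶠ i in l, IsFiniteMeasure (W i) ∧ W i (Icc 0 1)ᶜ = 0)
    (hV : V (Icc 0 1)ᶜ = 0)
    (hmom : ∀ n : ℕ, Tendsto (fun i => ∫ z, z ^ n ∂W i) l (𝓝 (∫ z, z ^ n ∂V)))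
    (p : Polynomial ℝ) :
    Tendsto (fun i => ∫ z, p.eval z ∂W i) l (𝓝 (∫ z, p.eval z ∂V)) := by
  have key : ∀ U : Measure ℝ, IsFiniteMeasure U → U (Icc 0 1)ᶜ = 0 →
      ∫ z, p.eval z ∂U = ∑ n ∈ Finset.range (p.natDegree + 1), p.coeff n * ∫ z, z ^ n ∂U := by
    intro U hU hU2
    simp_rw [Polynomial.eval_eq_sum_range]
    rw [integral_finsetSum]
    · simp_rw [integral_const_mul]
    · intro n _
      refine Integrable.const_mul ?_ _
      have hm : Measurable (fun z : ℝ => z ^ n) := by fun_prop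
      refine Integrable.of_bound hm.aestronglyMeasurable 1 ?_
      have : ∀ᵐ z ∂U, z ∈ Icc (0:ℝ) 1 := by rw [ae_iff]; exact hU2
      filter_upwards [this] with z hz
      rw [Real.norm_of_nonneg (pow_nonneg hz.1 n)]
      exact pow_le_one₀ hz.1 hz.2
  rw [key V inferInstance hV]
  have h := tendsto_finsetSum (Finset.range (p.natDegree + 1))
    (fun n _ => (hmom n).const_mul (p.coeff n))
  refine h.congr' ?_
  filter_upwards [hW] with i hi
  exact (key (W i) hi.1 hi.2).symm

lemma ae_Icc {U : Measure ℝ} (hU : U (Icc 0 1)ᶜ = 0) : ∀ᵐ z ∂U, z ∈ Icc (0:ℝ) 1 := by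
  rw [ae_iff]; exact hU

lemma cont_int {U : Measure ℝ} [IsFiniteMeasure U] (hU : U (Icc 0 1)ᶜ = 0) {f : ℝ → ℝ}
    (hf : Continuous f) : Integrable f U := by
  obtain ⟨B, hB⟩ := (isCompact_Icc (a := (0:ℝ)) (b := 1)).exists_bound_of_continuousOn
    hf.continuousOn
  refine Integrable.of_bound hf.aestronglyMeasurable B ?_
  filter_upwards [ae_Icc hU] with z hz using hB z hz

lemma cont_conv {ι : Type*} {l : Filter ι} {W : ι → Measure ℝ} {V : Measure ℝ}
    [IsFiniteMeasure V] (hW : ∀ᶠ i in l, IsFiniteMeasure (W i) ∧ W i (Icc 0 1)ᶜ = 0)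
    (hV : V (Icc 0 1)ᶜ = 0)
    (hmom : ∀ n : ℕ, Tendsto (fun i => ∫ z, z ^ n ∂W i) l (𝓝 (∫ z, z ^ n ∂V)))
    {f : ℝ → ℝ} (hf : Continuous f) :
    Tendsto (fun i => ∫ z, f z ∂W i) l (𝓝 (∫ z, f z ∂V)) := by
  rw [Metric.tendsto_nhds]
  intro ε hε
  have hm0 := hmom 0
  simp only [pow_zero, integral_const, smul_eq_mul, mul_one] at hm0
  set v := V.real univ with hv
  have hv0 : 0 ≤ v := measureReal_nonneg
  set δ := ε / (3 * (v + 1)) with hδ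
  have hδ0 : 0 < δ := by positivity
  obtain ⟨p, hp⟩ := exists_polynomial_near_of_continuousOn 0 1 f hf.continuousOn δ hδ0
  have key : ∀ U : Measure ℝ, IsFiniteMeasure U → U (Icc 0 1)ᶜ = 0 →
      |∫ z, p.eval z ∂U - ∫ z, f z ∂U| ≤ δ * U.real univ := by
    intro U hU hU2
    rw [← integral_sub (cont_int hU2 p.continuous) (cont_int hU2 hf), ← Real.norm_eq_abs]
    refine norm_integral_le_of_norm_le_const ?_
    filter_upwards [ae_Icc hU2] with z hz
    exact (hp z hz).le
  have hpm := poly_moment hW hV hmom p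
  rw [Metric.tendsto_nhds] at hpm
  filter_upwards [hW, hpm (ε / 3) (by positivity), hm0.eventually (gt_mem_nhds (lt_add_one v))]
    with i h1 h2 h3
  have k1 := key (W i) h1.1 h1.2
  have k2 := key V inferInstance hV
  rw [Real.dist_eq] at h2 ⊢
  have k3 : δ * (W i).real univ ≤ ε / 3 := by
    calc _ ≤ δ * (v + 1) := mul_le_mul_of_nonneg_left h3.le hδ0.le
      _ = ε / 3 := by rw [hδ]; field_simp
  have k4 : δ * V.real univ ≤ ε / 3 := by
    calc _ ≤ δ * (v + 1) := mul_le_mul_of_nonneg_left (by linarith) hδ0.le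
      _ = ε / 3 := by rw [hδ]; field_simp
  rw [abs_le] at k1 k2
  rw [abs_lt] at h2 ⊢
  constructor <;> linarith [k1.1, k1.2, k2.1, k2.2, h2.1, h2.2]

/-- a ramp -/
def ramp (c δ z : ℝ) : ℝ := max 0 (min 1 ((z - c) / δ))

lemma ramp_cont (c δ : ℝ) : Continuous (ramp c δ) := by unfold ramp; fun_prop
lemma ramp_nonneg (c δ z : ℝ) : 0 ≤ ramp c δ z := le_max_left _ _
lemma ramp_le_one (c δ z : ℝ) : ramp c δ z ≤ 1 := max_le zero_le_one (min_le_left _ _)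
lemma ramp_zero {c δ z : ℝ} (hδ : 0 < δ) (h : z ≤ c) : ramp c δ z = 0 := by
  unfold ramp
  have : (z - c) / δ ≤ 0 := div_nonpos_of_nonpos_of_nonneg (by linarith) hδ.le
  rw [max_eq_left]; exact (min_le_right _ _).trans this
lemma ramp_one {c δ z : ℝ} (hδ : 0 < δ) (h : c + δ ≤ z) : ramp c δ z = 1 := by
  unfold ramp
  have : 1 ≤ (z - c) / δ := by rw [le_div_iff₀ hδ]; linarith
  rw [min_eq_left this]; simp

lemma ind_conv {ι : Type*} {l : Filter ι} {W : ι → Measure ℝ} {V : Measure ℝ}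
    [IsFiniteMeasure V] (hW : ∀ᶠ i in l, IsFiniteMeasure (W i) ∧ W i (Icc 0 1)ᶜ = 0)
    (hV : V (Icc 0 1)ᶜ = 0)
    (hmom : ∀ n : ℕ, Tendsto (fun i => ∫ z, z ^ n ∂W i) l (𝓝 (∫ z, z ^ n ∂V)))
    {F : ℝ → ℝ} (hF : Continuous F) (hF0 : ∀ z, 0 ≤ F z) {c : ℝ} (hc : V {c} = 0) :
    Tendsto (fun i => ∫ z in Ici c, F z ∂W i) l (𝓝 (∫ z in Ici c, F z ∂V)) := by
  have hFV := cont_int hV hF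
  have hd : ∀ n : ℕ, (0:ℝ) < 1 / ((n:ℝ) + 1) := fun n => by positivity
  have hdlim := tendsto_one_div_add_atTop_nhds_zero_nat (𝕜 := ℝ)
  have hcae : ∀ᵐ z ∂V, z ≠ c := by rw [ae_iff]; simpa using hc
  -- lower
  have hlow : Tendsto (fun n : ℕ => ∫ z, ramp c (1 / ((n:ℝ) + 1)) z * F z ∂V) atTop
      (𝓝 (∫ z in Ici c, F z ∂V)) := by
    rw [← integral_indicator measurableSet_Ici]
    refine tendsto_integral_of_dominated_convergence F
      (fun n => ((ramp_cont _ _).mul hF).aestronglyMeasurable) hFV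
      (fun n => Eventually.of_forall fun z => ?_) ?_
    · rw [Real.norm_of_nonneg (mul_nonneg (ramp_nonneg _ _ _) (hF0 z))]
      exact mul_le_of_le_one_left (hF0 z) (ramp_le_one _ _ _)
    · filter_upwards [hcae] with z hz
      rcases lt_or_gt_of_ne hz with h | h
      · rw [indicator_of_notMem (by simpa using h)]
        refine tendsto_const_nhds.congr fun n => ?_
        rw [ramp_zero (hd n) h.le, zero_mul]
      · rw [indicator_of_mem (by exact h.le)]
        refine tendsto_const_nhds.congr' ?_
        filter_upwards [hdlim.eventually (gt_mem_nhds (sub_pos.2 h))] with n hn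
        rw [ramp_one (hd n) (by linarith), one_mul]
  have hup : Tendsto (fun n : ℕ => ∫ z, ramp (c - 1 / ((n:ℝ) + 1)) (1 / ((n:ℝ) + 1)) z * F z ∂V)
      atTop (𝓝 (∫ z in Ici c, F z ∂V)) := by
    rw [← integral_indicator measurableSet_Ici]
    refine tendsto_integral_of_dominated_convergence F
      (fun n => ((ramp_cont _ _).mul hF).aestronglyMeasurable) hFV
      (fun n => Eventually.of_forall fun z => ?_) (Eventually.of_forall fun z => ?_)
    · rw [Real.norm_of_nonneg (mul_nonneg (ramp_nonneg _ _ _) (hF0 z))]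
      exact mul_le_of_le_one_left (hF0 z) (ramp_le_one _ _ _)
    · rcases lt_or_ge z c with h | h
      · rw [indicator_of_notMem (by simpa using h)]
        refine tendsto_const_nhds.congr' ?_
        filter_upwards [hdlim.eventually (gt_mem_nhds (sub_pos.2 h))] with n hn
        rw [ramp_zero (hd n) (by linarith), zero_mul]
      · rw [indicator_of_mem (by exact h)]
        refine tendsto_const_nhds.congr fun n => ?_
        rw [ramp_one (hd n) (by linarith), one_mul]
  have cc := fun (c' δ : ℝ) => cont_conv hW hV hmom ((ramp_cont c' δ).mul hF)
  refine tendsto_order.2 ⟨fun a ha => ?_, fun a ha => ?_⟩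
  · obtain ⟨n, hn⟩ := (hlow.eventually (lt_mem_nhds ha)).exists
    filter_upwards [hW, (cc c (1 / ((n:ℝ) + 1))).eventually (lt_mem_nhds hn)] with i hi1 hi2
    have := hi1.1
    refine hi2.trans_le ?_
    rw [← integral_indicator measurableSet_Ici]
    refine integral_mono (cont_int hi1.2 ((ramp_cont _ _).mul hF))
      ((cont_int hi1.2 hF).indicator measurableSet_Ici) fun z => ?_
    simp only [Pi.mul_apply]
    rcases lt_or_ge z c with h | h
    · rw [indicator_of_notMem (by simpa using h), ramp_zero (hd n) h.le, zero_mul]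
    · rw [indicator_of_mem (by exact h)]
      exact mul_le_of_le_one_left (hF0 z) (ramp_le_one _ _ _)
  · obtain ⟨n, hn⟩ := (hup.eventually (gt_mem_nhds ha)).exists
    filter_upwards [hW, (cc (c - 1 / ((n:ℝ) + 1)) (1 / ((n:ℝ) + 1))).eventually
      (gt_mem_nhds hn)] with i hi1 hi2
    have := hi1.1
    refine lt_of_le_of_lt ?_ hi2
    rw [← integral_indicator measurableSet_Ici]
    refine integral_mono ((cont_int hi1.2 hF).indicator measurableSet_Ici)
      (cont_int hi1.2 ((ramp_cont _ _).mul hF)) fun z => ?_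
    simp only [Pi.mul_apply]
    rcases lt_or_ge z c with h | h
    · rw [indicator_of_notMem (by simpa using h)]
      exact mul_nonneg (ramp_nonneg _ _ _) (hF0 z)
    · rw [indicator_of_mem (by exact h), ramp_one (hd n) (by linarith), one_mul]

def gker (σ x : ℝ) : ℝ := Real.exp (-(σ * x)) - 1 + σ * x

def Psi (ν : Measure ℝ) (σ : ℝ) : ℝ := ∫ x, gker σ x ∂ν

def Wm (ν : Measure ℝ) (s : ℝ) : Measure ℝ :=
  (ν.withDensity (fun x => ENNReal.ofReal ((1 - Real.exp (-(s * x))) ^ 2 / Psi ν s))).map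
    (fun x => Real.exp (-(s * x)))

lemma gker_meas (σ : ℝ) : Measurable (gker σ) := by unfold gker; fun_prop

lemma gker_nonneg (σ x : ℝ) : 0 ≤ gker σ x := by
  have := Real.add_one_le_exp (-(σ * x))
  unfold gker; linarith

lemma gker_le {σ x : ℝ} (h : 0 ≤ σ * x) : gker σ x ≤ σ * x := by
  have : Real.exp (-(σ * x)) ≤ 1 := Real.exp_le_one_iff.2 (by linarith)
  unfold gker; linarith

lemma gker_le_sq {σ x : ℝ} (h : 0 ≤ σ * x) : gker σ x ≤ (σ * x) ^ 2 := by
  unfold gker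
  set u := σ * x
  have h1 := Real.add_one_le_exp u
  have h2 : Real.exp (-u) * Real.exp u = 1 := by rw [← Real.exp_add]; simp
  have h3 := Real.exp_pos (-u)
  have h4 : Real.exp (-u) * (u + 1) ≤ 1 := by
    exact (mul_le_mul_of_nonneg_left h1 h3.le).trans_eq h2
  have h5 : Real.exp (-u) * (u + 1) ≤ (1 - u + u ^ 2) * (u + 1) := by
    have : (1 - u + u ^ 2) * (u + 1) = 1 + u ^ 3 := by ring
    rw [this]; have := pow_nonneg h 3; linarith
  have := le_of_mul_le_mul_right h5 (by linarith)
  linarith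

lemma gker_diff (s x : ℝ) (n : ℕ) : Real.exp (-(s * x)) ^ n * (1 - Real.exp (-(s * x))) ^ 2 =
    gker (s * (n + 2)) x - 2 * gker (s * (n + 1)) x + gker (s * n) x := by
  unfold gker
  have e1 : Real.exp (-(s * n * x)) = Real.exp (-(s * x)) ^ n := by
    rw [← Real.exp_nat_mul]; congr 1; ring
  have e2 : Real.exp (-(s * (n + 1) * x)) = Real.exp (-(s * x)) ^ n * Real.exp (-(s * x)) := by
    rw [← e1, ← Real.exp_add]; congr 1; ring
  have e3 : Real.exp (-(s * (n + 2) * x)) = Real.exp (-(s * x)) ^ n * Real.exp (-(s * x))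
      * Real.exp (-(s * x)) := by
    rw [← e2, ← Real.exp_add]; congr 1; ring
  rw [e1, e2, e3]; ring

lemma Wm_integral {ν : Measure ℝ} {s : ℝ} (hψ : 0 < Psi ν s) {f : ℝ → ℝ} (hf : Measurable f) :
    ∫ z, f z ∂(Wm ν s) =
      ∫ x, f (Real.exp (-(s * x))) * (1 - Real.exp (-(s * x))) ^ 2 / Psi ν s ∂ν := by
  unfold Wm
  rw [integral_map (by fun_prop) hf.aestronglyMeasurable,
    integral_withDensity_eq_integral_toReal_smul (by fun_prop)
      (Eventually.of_forall fun x => ENNReal.ofReal_lt_top)]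
  refine integral_congr_ae (Eventually.of_forall fun x => ?_)
  simp only [smul_eq_mul]
  rw [ENNReal.toReal_ofReal (by positivity)]
  ring

lemma Wm_finite {ν : Measure ℝ} {s : ℝ} (hs : 0 ≤ s)
    (hintg : ∀ σ, 0 ≤ σ → Integrable (gker σ) ν) : IsFiniteMeasure (Wm ν s) := by
  unfold Wm
  have : IsFiniteMeasure (ν.withDensity
      (fun x => ENNReal.ofReal ((1 - Real.exp (-(s * x))) ^ 2 / Psi ν s))) := by
    refine isFiniteMeasure_withDensity_ofReal ?_
    have h := ((hintg (s * 2) (by positivity)).sub ((hintg (s * 1) (by positivity)).const_mul 2)).div_const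
      (Psi ν s)
    have h2 : (fun x => (1 - Real.exp (-(s * x))) ^ 2 / Psi ν s) =
        fun x => (gker (s * 2) x - 2 * gker (s * 1) x) / Psi ν s := by
      ext x
      have := gker_diff s x 0
      simp only [pow_zero, one_mul, Nat.cast_zero, zero_add, mul_zero] at this
      rw [this]; simp [gker]
    rw [h2]
    exact h.2
  infer_instance

lemma Wm_supp {ν : Measure ℝ} (hsupp : ν (Iic 0) = 0) {s : ℝ} (hs : 0 < s) :
    Wm ν s (Icc 0 1)ᶜ = 0 := by
  unfold Wm
  rw [Measure.map_apply (by fun_prop) measurableSet_Icc.compl]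
  refine withDensity_absolutelyContinuous _ _ ?_
  refine measure_mono_null ?_ hsupp
  intro x hx
  by_contra hcon
  simp only [mem_Iic, not_le] at hcon
  apply hx
  refine ⟨(Real.exp_pos _).le, Real.exp_le_one_iff.2 ?_⟩
  have := mul_pos hs hcon; linarith

lemma Wm_moment {ν : Measure ℝ} {s : ℝ} (hs : 0 ≤ s) (hψ : 0 < Psi ν s)
    (hintg : ∀ σ, 0 ≤ σ → Integrable (gker σ) ν) (n : ℕ) :
    ∫ z, z ^ n ∂(Wm ν s) = Psi ν (s * (n + 2)) / Psi ν s - 2 * (Psi ν (s * (n + 1)) / Psi ν s)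
      + Psi ν (s * n) / Psi ν s := by
  rw [Wm_integral hψ (by fun_prop)]
  simp_rw [gker_diff]
  have i1 := hintg (s * (n + 2)) (by positivity)
  have i2 := (hintg (s * (n + 1)) (by positivity)).const_mul 2
  have i3 := hintg (s * n) (by positivity)
  have i12 : Integrable (fun x => gker (s * (n + 2)) x - 2 * gker (s * (n + 1)) x) ν := i1.sub i2
  rw [integral_div, integral_add i12 i3, integral_sub i1 i2, integral_const_mul]
  simp only [Psi]
  ring

lemma Psi_zero (ν : Measure ℝ) : Psi ν 0 = 0 := by simp [Psi, gker]

/-- limiting measure -/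
def nuR (ρ : ℝ) : Measure ℝ :=
  (volume.restrict (Ioi 0)).withDensity (fun y => ENNReal.ofReal (y ^ (-2 - ρ)))

lemma nuR_ae (ρ : ℝ) : ∀ᵐ x ∂(nuR ρ), 0 < x := by
  refine (withDensity_absolutelyContinuous _ _).ae_le ?_
  exact ae_restrict_mem measurableSet_Ioi

lemma nuR_supp (ρ : ℝ) : nuR ρ (Iic 0) = 0 := by
  have := nuR_ae ρ
  rw [ae_iff] at this
  simpa [Iic] using this

lemma nuR_meas (ρ : ℝ) : Measurable (fun y : ℝ => ENNReal.ofReal (y ^ (-2 - ρ))) := by fun_prop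

lemma nuR_integral (ρ : ℝ) (f : ℝ → ℝ) :
    ∫ x, f x ∂(nuR ρ) = ∫ y in Ioi 0, y ^ (-2 - ρ) * f y := by
  unfold nuR
  rw [integral_withDensity_eq_integral_toReal_smul (nuR_meas ρ)
    (Eventually.of_forall fun x => ENNReal.ofReal_lt_top)]
  refine setIntegral_congr_fun measurableSet_Ioi fun y hy => ?_
  simp only [smul_eq_mul]
  rw [ENNReal.toReal_ofReal (Real.rpow_nonneg (le_of_lt hy) _)]

lemma nuR_int {ρ : ℝ} (hρ : 0 < ρ) (hρ1 : ρ < 1) (σ : ℝ) (hσ : 0 ≤ σ) :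
    Integrable (gker σ) (nuR ρ) := by
  unfold nuR
  rw [integrable_withDensity_iff_integrable_smul' (nuR_meas ρ)
    (Eventually.of_forall fun x => ENNReal.ofReal_lt_top)]
  have hm : Measurable (fun x : ℝ => (ENNReal.ofReal (x ^ (-2 - ρ))).toReal • gker σ x) :=
    (nuR_meas ρ).ennreal_toReal.smul (gker_meas σ)
  change IntegrableOn _ (Ioi 0) volume
  rw [← Ioc_union_Ioi_eq_Ioi zero_le_one]
  refine IntegrableOn.union ?_ ?_
  · have h1 : IntegrableOn (fun x : ℝ => σ ^ 2 * x ^ (-ρ)) (Ioc 0 1) := by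
      refine Integrable.const_mul ?_ _
      have := intervalIntegral.intervalIntegrable_rpow' (a := 0) (b := 1) (r := -ρ) (by linarith)
      rwa [intervalIntegrable_iff_integrableOn_Ioc_of_le zero_le_one] at this
    refine Integrable.mono' h1 hm.aestronglyMeasurable ?_
    refine (ae_restrict_iff' measurableSet_Ioc).2 (Eventually.of_forall fun x hx => ?_)
    have hx0 : 0 < x := hx.1
    have hr := Real.rpow_nonneg hx0.le (-2 - ρ)
    rw [ENNReal.toReal_ofReal hr, smul_eq_mul,
      Real.norm_of_nonneg (mul_nonneg hr (gker_nonneg _ _))]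
    calc x ^ (-2 - ρ) * gker σ x ≤ x ^ (-2 - ρ) * (σ * x) ^ 2 :=
          mul_le_mul_of_nonneg_left (gker_le_sq (by positivity)) hr
      _ = σ ^ 2 * (x ^ (-2 - ρ) * x ^ (2:ℝ)) := by rw [Real.rpow_two]; ring
      _ = σ ^ 2 * x ^ (-ρ) := by rw [← Real.rpow_add hx0]; congr 2; ring
  · have h1 : IntegrableOn (fun x : ℝ => σ * x ^ (-1 - ρ)) (Ioi 1) :=
      (integrableOn_Ioi_rpow_of_lt (by linarith) one_pos).const_mul _
    refine Integrable.mono' h1 hm.aestronglyMeasurable ?_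
    refine (ae_restrict_iff' measurableSet_Ioi).2 (Eventually.of_forall fun x hx => ?_)
    have hx0 : 0 < x := one_pos.trans hx
    have hr := Real.rpow_nonneg hx0.le (-2 - ρ)
    rw [ENNReal.toReal_ofReal hr, smul_eq_mul,
      Real.norm_of_nonneg (mul_nonneg hr (gker_nonneg _ _))]
    calc x ^ (-2 - ρ) * gker σ x ≤ x ^ (-2 - ρ) * (σ * x) :=
          mul_le_mul_of_nonneg_left (gker_le (by positivity)) hr
      _ = σ * (x ^ (-2 - ρ) * x ^ (1:ℝ)) := by rw [Real.rpow_one]; ring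
      _ = σ * x ^ (-1 - ρ) := by rw [← Real.rpow_add hx0]; congr 2; ring

lemma gker_pos {σ x : ℝ} (h : 0 < σ * x) : 0 < gker σ x := by
  have := Real.add_one_lt_exp (x := -(σ * x)) (by linarith)
  unfold gker; linarith

lemma Psi_pos {ν : Measure ℝ} (hsupp : ν (Iic 0) = 0) (hν : ν ≠ 0) {σ : ℝ} (hσ : 0 < σ)
    (hintg : Integrable (gker σ) ν) : 0 < Psi ν σ := by
  unfold Psi
  rw [integral_pos_iff_support_of_nonneg (fun x => gker_nonneg σ x) hintg]
  rw [pos_iff_ne_zero]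
  intro h0
  apply hν
  rw [← Measure.measure_univ_eq_zero]
  refine measure_mono_null (t := Iic 0 ∪ Function.support (gker σ)) ?_ (measure_union_null hsupp h0)
  intro x _
  rcases le_or_gt x 0 with h | h
  · exact Or.inl h
  · exact Or.inr (gker_pos (mul_pos hσ h)).ne'

lemma nuR_Psi {ρ : ℝ} {v : ℝ} (hv : 0 < v) :
    Psi (nuR ρ) v = v ^ (1 + ρ) * Psi (nuR ρ) 1 := by
  unfold Psi
  rw [nuR_integral, nuR_integral]
  have h := integral_comp_mul_left_Ioi (fun z => z ^ (-2 - ρ) * gker 1 z) 0 hv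
  simp only [mul_zero, smul_eq_mul] at h
  have h2 : ∫ z in Ioi 0, z ^ (-2 - ρ) * gker 1 z
      = v * ∫ x in Ioi 0, (v * x) ^ (-2 - ρ) * gker 1 (v * x) := by
    rw [h]; field_simp
  rw [h2, ← mul_assoc, ← integral_const_mul]
  refine setIntegral_congr_fun measurableSet_Ioi fun y hy => ?_
  have hy0 : (0:ℝ) < y := hy
  change y ^ (-2 - ρ) * gker v y = v ^ (1 + ρ) * v * ((v * y) ^ (-2 - ρ) * gker 1 (v * y))
  rw [Real.mul_rpow hv.le hy0.le]
  have e : gker 1 (v * y) = gker v y := by simp [gker]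
  rw [e]
  have e2 : v ^ (1 + ρ) * v * v ^ (-2 - ρ) = 1 := by
    nth_rewrite 2 [← Real.rpow_one v]
    rw [← Real.rpow_add hv, ← Real.rpow_add hv]
    ring_nf; simp
  calc y ^ (-2 - ρ) * gker v y = (v ^ (1 + ρ) * v * v ^ (-2 - ρ)) * (y ^ (-2 - ρ) * gker v y) := by
        rw [e2, one_mul]
    _ = _ := by ring

lemma nuR_pos_meas {ρ : ℝ} {S : Set ℝ} (hS : MeasurableSet S) (h : nuR ρ S = 0) :
    volume (S ∩ Ioi 0) = 0 := by
  unfold nuR at h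
  rw [withDensity_apply_eq_zero (nuR_meas ρ), Measure.restrict_apply] at h
  · refine measure_mono_null ?_ h
    rintro x ⟨hx, hx0⟩
    refine ⟨⟨?_, hx⟩, hx0⟩
    simp only [mem_ofPred_eq, ne_eq, ENNReal.ofReal_eq_zero, not_le]
    exact Real.rpow_pos_of_pos hx0 _
  · refine MeasurableSet.inter ?_ hS
    exact (nuR_meas ρ) (measurableSet_singleton 0).compl

lemma limit_exists {ρ : ℝ} (hρ : ρ ∈ Ioc (0:ℝ) 1) {c : ℝ} (hc0 : 0 < c) (hc1 : c < 1) :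
    ∃ V : Measure ℝ, IsFiniteMeasure V ∧ V (Icc 0 1)ᶜ = 0 ∧ V {c} = 0 ∧ V (Ici c) ≠ 0 ∧
      ∀ n : ℕ, ∫ z, z ^ n ∂V = ((n:ℝ) + 2) ^ (1 + ρ) - 2 * ((n:ℝ) + 1) ^ (1 + ρ)
        + (n:ℝ) ^ (1 + ρ) := by
  rcases eq_or_lt_of_le hρ.2 with h1 | h1
  · subst h1
    refine ⟨(2 : ENNReal) • Measure.dirac 1, ⟨?_⟩, ?_, ?_, ?_, ?_⟩
    · simp
    · simp
    · simp [hc1.ne']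
    · simp [hc1.le]
    · intro n
      rw [integral_smul_measure, integral_dirac]
      norm_num
      ring
  · have hintg := nuR_int hρ.1 h1
    have hne : nuR ρ ≠ 0 := by
      intro h
      have := nuR_pos_meas (ρ := ρ) MeasurableSet.univ (by rw [h]; simp)
      simp at this
    have hψ := Psi_pos (nuR_supp ρ) hne one_pos (hintg 1 zero_le_one)
    have hvc : volume.restrict (Ioi (0:ℝ)) ((fun x => Real.exp (-(1 * x))) ⁻¹' {c}) = 0 := by
      refine measure_mono_null (t := {-Real.log c}) ?_ ?_
      · intro x hx
        simp only [mem_preimage, mem_singleton_iff] at hx ⊢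
        rw [← hx, Real.log_exp]; ring
      · exact le_antisymm ((Measure.restrict_apply_le _ _).trans (by simp)) bot_le
    refine ⟨Wm (nuR ρ) 1, Wm_finite zero_le_one hintg, Wm_supp (nuR_supp ρ) one_pos, ?_, ?_, ?_⟩
    · unfold Wm
      rw [Measure.map_apply (by fun_prop) (measurableSet_singleton c)]
      exact withDensity_absolutelyContinuous _ _ (withDensity_absolutelyContinuous _ _ hvc)
    · unfold Wm
      rw [Measure.map_apply (by fun_prop) measurableSet_Ici]
      intro h
      rw [withDensity_apply_eq_zero (by fun_prop)] at h
      have h2 := nuR_pos_meas (ρ := ρ) (S := Ioo 0 (-Real.log c)) measurableSet_Ioo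
        (measure_mono_null ?_ h)
      · have : Ioo 0 (-Real.log c) ∩ Ioi 0 = Ioo 0 (-Real.log c) :=
          inter_eq_left.2 fun x hx => hx.1
        rw [this, Real.volume_Ioo, ENNReal.ofReal_eq_zero] at h2
        have := Real.log_neg hc0 hc1
        linarith
      · intro x hx
        refine ⟨?_, ?_⟩
        · simp only [mem_ofPred_eq, ne_eq, ENNReal.ofReal_eq_zero, not_le]
          refine div_pos (pow_pos (sub_pos.2 (Real.exp_lt_one_iff.2 ?_)) 2) hψ
          linarith [hx.1]
        · simp only [mem_preimage, mem_Ici]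
          rw [← Real.log_le_iff_le_exp hc0]
          linarith [hx.2]
    · intro n
      rw [Wm_moment zero_le_one hψ hintg]
      simp only [one_mul]
      rw [nuR_Psi (by positivity : (0:ℝ) < n + 2), nuR_Psi (by positivity : (0:ℝ) < n + 1),
        mul_div_cancel_right₀ _ hψ.ne', mul_div_cancel_right₀ _ hψ.ne']
      congr 1
      rcases Nat.eq_zero_or_pos n with h | h
      · subst h
        have : (1 + ρ) ≠ 0 := by linarith [hρ.1]
        simp [Psi_zero, Real.zero_rpow this]
      · rw [nuR_Psi (by exact_mod_cast h), mul_div_cancel_right₀ _ hψ.ne']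

def FF (c z : ℝ) : ℝ := (dslope Real.log 1 (max z c)) ^ 2

lemma FF_cont {c : ℝ} (hc : 0 < c) : Continuous (FF c) := by
  unfold FF
  refine Continuous.pow ?_ 2
  have h : ContinuousOn (dslope Real.log 1) (Ioi 0) := by
    rw [continuousOn_dslope (Ioi_mem_nhds one_pos)]
    refine ⟨fun x hx => (Real.continuousAt_log (ne_of_gt hx)).continuousWithinAt, ?_⟩
    exact Real.differentiableAt_log one_ne_zero
  refine h.comp_continuous (by fun_prop) fun z => ?_
  exact hc.trans_le (le_max_right _ _)

lemma FF_eq {c z : ℝ} (hcz : c ≤ z) : FF c z * (1 - z) ^ 2 = Real.log z ^ 2 := by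
  unfold FF
  rw [max_eq_left hcz]
  rcases eq_or_ne z 1 with h | h
  · subst h; simp
  · rw [dslope_of_ne _ h, slope_def_field, Real.log_one]
    have : z - 1 ≠ 0 := sub_ne_zero.2 h
    field_simp
    ring

lemma FF_pos {c : ℝ} (hc : 0 < c) (z : ℝ) : 0 < FF c z := by
  unfold FF
  set w := max z c
  have hw : 0 < w := hc.trans_le (le_max_right _ _)
  apply pow_pos
  rcases eq_or_ne w 1 with h | h
  · rw [h, dslope_same, Real.deriv_log]; norm_num
  · rw [dslope_of_ne _ h, slope_def_field, Real.log_one, sub_zero]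
    rcases lt_or_gt_of_ne h with h | h
    · exact div_pos_of_neg_of_neg (Real.log_neg hw h) (by linarith)
    · exact div_pos (Real.log_pos h) (by linarith)

lemma taub {ν : Measure ℝ} (hsupp : ν (Iic 0) = 0)
    (hintg : ∀ σ, 0 ≤ σ → Integrable (gker σ) ν) (hψ : ∀ s, 0 < s → 0 < Psi ν s)
    {ρ : ℝ} (hρ : ρ ∈ Ioc (0:ℝ) 1)
    (hrv : ∀ v, 0 < v → Tendsto (fun s => Psi ν (s * v) / Psi ν s) (𝓝[>] 0) (𝓝 (v ^ (1 + ρ)))) :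
    ∃ c0 : ℝ, 0 < c0 ∧ Tendsto (fun s => s ^ 2 * (∫ y in Ioc 0 (1 / s), y ^ 2 ∂ν) / Psi ν s)
      (𝓝[>] 0) (𝓝 c0) := by
  set c := Real.exp (-1) with hc
  have hc0 : 0 < c := Real.exp_pos _
  have hc1 : c < 1 := Real.exp_lt_one_iff.2 (by norm_num)
  obtain ⟨V, hVf, hVs, hVc, hVp, hVm⟩ := limit_exists hρ hc0 hc1
  have hpos : ∀ᵐ x ∂ν, 0 < x := by
    rw [ae_iff]; simpa [Iic] using hsupp
  have hW : ∀ᶠ s in 𝓝[>] (0:ℝ), IsFiniteMeasure (Wm ν s) ∧ Wm ν s (Icc 0 1)ᶜ = 0 := by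
    filter_upwards [self_mem_nhdsWithin] with s hs
    exact ⟨Wm_finite (le_of_lt hs) hintg, Wm_supp hsupp hs⟩
  have hmom : ∀ n : ℕ, Tendsto (fun s => ∫ z, z ^ n ∂Wm ν s) (𝓝[>] 0) (𝓝 (∫ z, z ^ n ∂V)) := by
    intro n
    rw [hVm n]
    have hn : Tendsto (fun s => Psi ν (s * n) / Psi ν s) (𝓝[>] 0) (𝓝 ((n:ℝ) ^ (1 + ρ))) := by
      rcases Nat.eq_zero_or_pos n with h | h
      · subst h
        have : (1 + ρ) ≠ 0 := by linarith [hρ.1]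
        simp [Psi_zero, Real.zero_rpow this]
      · exact hrv n (by exact_mod_cast h)
    have h := ((hrv (n + 2) (by positivity)).sub ((hrv (n + 1) (by positivity)).const_mul 2)).add hn
    refine h.congr' ?_
    filter_upwards [self_mem_nhdsWithin] with s hs
    rw [Wm_moment (le_of_lt hs) (hψ s hs) hintg]
  have hconv := ind_conv hW hVs hmom (FF_cont hc0) (fun z => (FF_pos hc0 z).le) hVc
  refine ⟨_, ?_, hconv.congr' ?_⟩
  · rw [setIntegral_pos_iff_support_of_nonneg_ae
      (Eventually.of_forall fun z => (FF_pos hc0 z).le) (cont_int hVs (FF_cont hc0)).integrableOn]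
    have : Function.support (FF c) ∩ Ici c = Ici c :=
      inter_eq_right.2 fun z _ => (FF_pos hc0 z).ne'
    rw [this]
    exact pos_iff_ne_zero.2 hVp
  · filter_upwards [self_mem_nhdsWithin] with s hs
    have hs0 : (0:ℝ) < s := hs
    rw [← integral_indicator measurableSet_Ici, Wm_integral (hψ s hs)
      ((FF_cont hc0).measurable.indicator measurableSet_Ici), integral_div,
      ← integral_indicator measurableSet_Ioc, ← integral_const_mul]
    congr 1
    refine integral_congr_ae ?_
    filter_upwards [hpos] with x hx
    by_cases h : x ≤ 1 / s
    · have hsx : s * x ≤ 1 := by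
        rw [le_div_iff₀ hs0] at h; linarith
      have hcz : c ≤ Real.exp (-(s * x)) := Real.exp_le_exp.2 (by linarith)
      rw [indicator_of_mem (mem_Ici.2 hcz), indicator_of_mem (mem_Ioc.2 ⟨hx, h⟩), FF_eq hcz, Real.log_exp]
      ring
    · have hsx : 1 < s * x := by
        rw [not_le, div_lt_iff₀ hs0] at h; linarith
      have hcz : ¬ (c ≤ Real.exp (-(s * x))) := not_le.2 (Real.exp_lt_exp.2 (by linarith))
      rw [indicator_of_notMem (by simpa using hcz), indicator_of_notMem (fun hh => h hh.2)]
      simp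

lemma exp_conv_aux {u v : ℝ} (hv : 1 ≤ v) :
    1 - Real.exp (-(v * u)) ≤ v * (1 - Real.exp (-u)) := by
  have h0 : 0 < v := by linarith
  have ha : 0 ≤ 1 - 1 / v := by rw [sub_nonneg, div_le_one h0]; exact hv
  have hb : 0 ≤ 1 / v := by positivity
  have hab : 1 - 1 / v + 1 / v = 1 := by ring
  have := convexOn_exp.2 (mem_univ 0) (mem_univ (-(v * u))) ha hb hab
  simp only [smul_eq_mul, mul_zero, zero_add, Real.exp_zero, mul_one] at this
  have e : 1 / v * -(v * u) = -u := by field_simp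
  rw [e] at this
  have h2 := mul_le_mul_of_nonneg_left this h0.le
  have e2 : v * (1 - 1 / v + 1 / v * Real.exp (-(v * u))) = v - 1 + Real.exp (-(v * u)) := by
    field_simp
  linarith

lemma gker_mono {s r x : ℝ} (hs : 0 < s) (hsr : s ≤ r) : gker s x / s ≤ gker r x / r := by
  have hr := hs.trans_le hsr
  rw [div_le_div_iff₀ hs hr]
  have := exp_conv_aux (u := s * x) (v := r / s) ((one_le_div hs).2 hsr)
  have e : r / s * (s * x) = r * x := by field_simp
  rw [e] at this
  have h2 := mul_le_mul_of_nonneg_left this hs.le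
  have e2 : s * (r / s * (1 - Real.exp (-(s * x)))) = r * (1 - Real.exp (-(s * x))) := by
    field_simp
  unfold gker
  nlinarith

lemma gker_anti_aux {v : ℝ} (hv : 1 ≤ v) {u : ℝ} (hu : 0 ≤ u) :
    gker v u ≤ v ^ 2 * gker 1 u := by
  have hd : ∀ σ u : ℝ, HasDerivAt (fun u => gker σ u) (σ * (1 - Real.exp (-(σ * u)))) u := by
    intro σ u
    have h0 : HasDerivAt (fun u : ℝ => σ * u) (σ * 1) u := (hasDerivAt_id u).const_mul σ
    have h1 := (h0.neg.exp.sub_const 1).add h0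
    refine HasDerivAt.congr_deriv (f := fun u => gker σ u) h1 ?_
    simp only [Pi.neg_apply]; ring
  have hD : ∀ u, HasDerivAt (fun u => v ^ 2 * gker 1 u - gker v u)
      (v ^ 2 * (1 * (1 - Real.exp (-(1 * u)))) - v * (1 - Real.exp (-(v * u)))) u :=
    fun u => ((hd 1 u).const_mul _).sub (hd v u)
  have hm : MonotoneOn (fun u => v ^ 2 * gker 1 u - gker v u) (Ici 0) := by
    refine monotoneOn_of_deriv_nonneg (convex_Ici 0)
      (fun u _ => (hD u).continuousAt.continuousWithinAt)
      (fun u _ => (hD u).differentiableAt.differentiableWithinAt) ?_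
    intro u _
    rw [(hD u).deriv]
    have := exp_conv_aux (u := u) hv
    simp only [one_mul]
    nlinarith
  have := hm (mem_Ici.2 le_rfl) (mem_Ici.2 hu) hu
  simp only [gker] at this ⊢
  simp at this
  rw [one_mul]
  linarith

lemma gker_anti {s r x : ℝ} (hx : 0 ≤ x) (hs : 0 < s) (hsr : s ≤ r) :
    gker r x / r / r ≤ gker s x / s / s := by
  have hr := hs.trans_le hsr
  have := gker_anti_aux (v := r / s) ((one_le_div hs).2 hsr) (u := s * x) (by positivity)
  have e1 : gker (r / s) (s * x) = gker r x := by
    unfold gker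
    have : r / s * (s * x) = r * x := by field_simp
    rw [this]
  have e2 : gker 1 (s * x) = gker s x := by simp [gker]
  rw [e1, e2, div_pow, div_mul_eq_mul_div, le_div_iff₀ (by positivity)] at this
  rw [div_div, div_div, div_le_div_iff₀ (by positivity) (by positivity)]
  linarith

lemma cont_of_bounds {a : ℝ → ℝ} (hapos : ∀ s, 0 < s → 0 < a s)
    (ha : ∀ s r, 0 < s → s ≤ r → a s ≤ a r) (ha2 : ∀ s r, 0 < s → s ≤ r → a r / r ≤ a s / s) :
    ContinuousOn a (Ioi 0) := by
  intro x hx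
  have hx0 : (0:ℝ) < x := hx
  refine ContinuousAt.continuousWithinAt ?_
  have hu : Tendsto (fun y => a x * max 1 (y / x)) (𝓝 x) (𝓝 (a x)) := by
    have : Continuous (fun y => a x * max 1 (y / x)) := by fun_prop
    have h := this.tendsto x
    simpa [div_self hx0.ne'] using h
  have hl : Tendsto (fun y => a x * min 1 (y / x)) (𝓝 x) (𝓝 (a x)) := by
    have : Continuous (fun y => a x * min 1 (y / x)) := by fun_prop
    have h := this.tendsto x
    simpa [div_self hx0.ne'] using h
  have hax := hapos x hx0
  refine tendsto_of_tendsto_of_tendsto_of_le_of_le' hl hu ?_ ?_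
  · filter_upwards [Ioi_mem_nhds hx0] with y hy
    have hy0 : (0:ℝ) < y := hy
    rcases le_total x y with h | h
    · calc _ ≤ a x * 1 := mul_le_mul_of_nonneg_left (min_le_left _ _) hax.le
        _ ≤ a y := by rw [mul_one]; exact ha x y hx0 h
    · calc _ ≤ a x * (y / x) := mul_le_mul_of_nonneg_left (min_le_right _ _) hax.le
        _ ≤ a y := by
          have := ha2 y x hy0 h
          rw [div_le_div_iff₀ hx0 hy0] at this
          rw [← mul_div_assoc, div_le_iff₀ hx0]; exact this
  · filter_upwards [Ioi_mem_nhds hx0] with y hy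
    have hy0 : (0:ℝ) < y := hy
    rcases le_total x y with h | h
    · calc a y ≤ a x * (y / x) := by
            have := ha2 x y hx0 h
            rw [div_le_div_iff₀ hy0 hx0] at this
            rw [← mul_div_assoc, le_div_iff₀ hx0]; exact this
        _ ≤ _ := mul_le_mul_of_nonneg_left (le_max_right _ _) hax.le
    · calc a y ≤ a x * 1 := by rw [mul_one]; exact ha y x hy0 h
        _ ≤ _ := mul_le_mul_of_nonneg_left (le_max_left _ _) hax.le

lemma h_tendsto {ν : Measure ℝ} (hsupp : ν (Iic 0) = 0) (hid : Integrable (fun x : ℝ => x) ν) :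
    Tendsto (fun s => Psi ν s / s) (𝓝[>] 0) (𝓝 0) := by
  have hpos : ∀ᵐ x ∂ν, 0 < x := by
    rw [ae_iff]; simpa [Iic] using hsupp
  have h : Tendsto (fun s => ∫ x, gker s x / s ∂ν) (𝓝[>] 0) (𝓝 (∫ _x, (0:ℝ) ∂ν)) := by
    refine tendsto_integral_filter_of_dominated_convergence (fun x => x) ?_ ?_ hid ?_
    · exact Eventually.of_forall fun s => ((gker_meas s).div_const s).aestronglyMeasurable
    · filter_upwards [self_mem_nhdsWithin] with s hs
      have hs0 : (0:ℝ) < s := hs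
      filter_upwards [hpos] with x hx
      rw [Real.norm_of_nonneg (div_nonneg (gker_nonneg _ _) hs0.le), div_le_iff₀ hs0]
      linarith [gker_le (mul_pos hs0 hx).le]
    · filter_upwards [hpos] with x hx
      have hu : Tendsto (fun s : ℝ => s * x ^ 2) (𝓝[>] 0) (𝓝 0) := by
        have : Continuous (fun s : ℝ => s * x ^ 2) := by fun_prop
        have h := this.tendsto 0
        rw [zero_mul] at h
        exact h.mono_left nhdsWithin_le_nhds
      refine tendsto_of_tendsto_of_tendsto_of_le_of_le' tendsto_const_nhds hu ?_ ?_
      · filter_upwards [self_mem_nhdsWithin] with s hs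
        exact div_nonneg (gker_nonneg _ _) (le_of_lt hs)
      · filter_upwards [self_mem_nhdsWithin] with s hs
        have hs0 : (0:ℝ) < s := hs
        rw [div_le_iff₀ hs0]
        have := gker_le_sq (mul_pos hs0 hx).le
        nlinarith
  simp only [integral_zero, integral_div] at h
  exact h

lemma int_mono {ν : Measure ℝ} (hmass : ∫⁻ x, ENNReal.ofReal x ∂ν ≤ 1) :
    Monotone (fun y => ∫ x in Ioc 0 y, x ∂ν) := by
  intro y z hyz
  have h1 := setint_facts hmass y
  have h2 := setint_facts hmass z
  refine (ENNReal.ofReal_le_ofReal_iff h2.2.1).1 ?_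
  rw [h1.1, h2.1]
  exact lintegral_mono_set (Ioc_subset_Ioc_right hyz)

theorem additive_kernel_scaling_necessity
    -- ν₀ : positive measure on (0,∞) with total mass ∫ x ν₀(dx) = 1
    (ν₀ : Measure ℝ) (hν₀supp : ν₀ (Set.Iic 0) = 0)
    (hmass : ∫⁻ x, ENNReal.ofReal x ∂ν₀ = 1)
    -- desingularized Laplace transform of ν₀
    (φ₀ : ℝ → ℝ) (hφ₀ : ∀ s : ℝ, φ₀ s = ∫ x, (1 - Real.exp (-(s * x))) ∂ν₀)
    -- characteristic map: σ(t,s) > 0 solves s = σ − (1 − e^{−t}) φ₀(σ)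
    (σ : ℝ → ℝ → ℝ)
    (hσ : ∀ t : ℝ, 0 ≤ t → ∀ s : ℝ, 0 < s →
      0 < σ t s ∧ s = σ t s - (1 - Real.exp (-t)) * φ₀ (σ t s))
    -- (ν t) is the solution: its desingularized Laplace transform is e^{−t} φ₀(σ(t,s))
    (ν : ℝ → Measure ℝ)
    (hsol : ∀ t : ℝ, 0 ≤ t → (ν t) (Set.Iic 0) = 0 ∧
      ∀ s : ℝ, 0 < s →
        ∫ x, (1 - Real.exp (-(s * x))) ∂(ν t) = Real.exp (-t) * φ₀ (σ t s))
    -- mass distribution function M(t,x) = ∫₀^x y ν_t(dy)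
    (M : ℝ → ℝ → ℝ)
    (hM : ∀ t : ℝ, 0 ≤ t → ∀ x : ℝ, M t x = ∫ y in Set.Ioc (0:ℝ) x, y ∂(ν t))
    -- rescaling λ(t) → ∞
    (lam : ℝ → ℝ) (hlam_pos : ∀ t : ℝ, 0 < t → 0 < lam t)
    (hlam : Tendsto lam atTop atTop)
    -- M⋆ : nontrivial probability distribution function
    (Mstar : ℝ → ℝ)
    (hM_mono : Monotone Mstar)
    (hM_rc : ∀ x : ℝ, ContinuousWithinAt Mstar (Set.Ici x) x)
    (hM_nonneg : ∀ x : ℝ, 0 ≤ Mstar x)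
    (hM_one : Tendsto Mstar atTop (𝓝 1))
    (hM_nontrivial : ∃ x : ℝ, 0 < x ∧ Mstar x < 1)
    -- convergence M(t, λ(t) x) → M⋆(x) at continuity points of M⋆
    (hconv : ∀ x : ℝ, 0 < x → ContinuousAt Mstar x →
      Tendsto (fun t => M t (lam t * x)) atTop (𝓝 (Mstar x))) :
    -- conclusion: ∫₀^x y² ν₀(dy) ~ x^{1-ρ} L(x) as x → ∞, with 0 < ρ ≤ 1, L slowly varying
    ∃ ρ : ℝ, ρ ∈ Set.Ioc (0:ℝ) 1 ∧ ∃ L : ℝ → ℝ,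
      (∀ x : ℝ, 0 < x → 0 < L x) ∧
      (∀ c : ℝ, 0 < c → Tendsto (fun x => L (c * x) / L x) atTop (𝓝 1)) ∧
      Tendsto (fun x => (∫ y in Set.Ioc (0:ℝ) x, y ^ 2 ∂ν₀) / (x ^ (1 - ρ) * L x))
        atTop (𝓝 1) := by
  have hpos₀ : ∀ᵐ x ∂ν₀, 0 < x := by
    rw [ae_iff]; simpa [Iic] using hν₀supp
  have hne : ν₀ ≠ 0 := by
    intro h; rw [h] at hmass; simp at hmass
  have hnn0 : 0 ≤ᵐ[ν₀] fun x : ℝ => x := by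
    filter_upwards [hpos₀] with x hx using hx.le
  have hid : Integrable (fun x : ℝ => x) ν₀ := by
    refine ⟨measurable_id.aestronglyMeasurable, ?_⟩
    rw [hasFiniteIntegral_iff_ofReal hnn0, hmass]
    exact ENNReal.one_lt_top
  have hid1 : ∫ x, x ∂ν₀ = 1 := by
    rw [integral_eq_lintegral_of_nonneg_ae hnn0 measurable_id.aestronglyMeasurable, hmass]
    simp
  have hgint : ∀ σ, 0 ≤ σ → Integrable (gker σ) ν₀ := by
    intro σ hσ0
    refine Integrable.mono' (hid.const_mul σ) (gker_meas σ).aestronglyMeasurable ?_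
    filter_upwards [hpos₀] with x hx
    rw [Real.norm_of_nonneg (gker_nonneg _ _)]
    exact gker_le (mul_nonneg hσ0 hx.le)
  have heint : ∀ s, 0 ≤ s → Integrable (fun x => 1 - Real.exp (-(s * x))) ν₀ := by
    intro s hs
    refine ((hid.const_mul s).sub (hgint s hs)).congr (Eventually.of_forall fun x => ?_)
    simp only [Pi.sub_apply, gker]; ring
  have hPsi : ∀ s, 0 ≤ s → Psi ν₀ s = s - φ₀ s := by
    intro s hs
    have h1 : ∫ x, (s * x - (1 - Real.exp (-(s * x)))) ∂ν₀ = s - φ₀ s := by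
      rw [integral_sub (hid.const_mul s) (heint s hs), integral_const_mul, hid1, hφ₀, mul_one]
    rw [← h1]
    unfold Psi
    congr 1; ext x; simp only [gker]; ring
  have hψpos : ∀ s, 0 < s → 0 < Psi ν₀ s := fun s hs =>
    Psi_pos hν₀supp hne hs (hgint s hs.le)
  have hφpos : ∀ s, 0 < s → 0 < φ₀ s := by
    intro s hs
    rw [hφ₀]
    rw [integral_pos_iff_support_of_nonneg_ae _ (heint s hs.le)]
    · rw [pos_iff_ne_zero]
      intro h0
      apply hne
      rw [← Measure.measure_univ_eq_zero]
      refine measure_mono_null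
        (t := Iic 0 ∪ Function.support (fun x : ℝ => 1 - Real.exp (-(s * x)))) ?_
        (measure_union_null hν₀supp h0)
      intro x _
      rcases le_or_gt x 0 with h | h
      · exact Or.inl h
      · right
        have : Real.exp (-(s * x)) < 1 := Real.exp_lt_one_iff.2 (by linarith [mul_pos hs h])
        exact (sub_pos.2 this).ne'
    · filter_upwards [hpos₀] with x hx
      exact sub_nonneg.2 (Real.exp_le_one_iff.2 (by linarith [mul_pos hs hx]))
  -- the solution has mass at most one
  have hmt : ∀ t, 0 ≤ t → ∫⁻ x, ENNReal.ofReal x ∂(ν t) ≤ 1 := by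
    intro t ht
    obtain ⟨hsup, hlap⟩ := hsol t ht
    refine mass_le ?_ hsup ?_
    · intro s hs
      by_contra hcon
      have h1 := hlap s hs
      rw [integral_undef hcon] at h1
      have := mul_pos (Real.exp_pos (-t)) (hφpos _ (hσ t ht s hs).1)
      linarith
    · intro s hs
      rw [hlap s hs]
      obtain ⟨g1, g2⟩ := hσ t ht s hs
      have g3 := hψpos _ g1
      rw [hPsi _ g1.le] at g3
      linarith
  have hMmono : ∀ t, 0 ≤ t → Monotone (M t) := by
    intro t ht
    have : M t = fun y => ∫ x in Ioc 0 y, x ∂(ν t) := funext (hM t ht)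
    rw [this]; exact int_mono (hmt t ht)
  have hlapM : ∀ t, 0 ≤ t → ∀ s, 0 < s → Real.exp (-t) * φ₀ (σ t s) = aF (M t) s := by
    intro t ht s hs
    have : M t = fun y => ∫ x in Ioc 0 y, x ∂(ν t) := funext (hM t ht)
    rw [this, ← laplace_rep (hsol t ht).1 (hmt t ht) hs, (hsol t ht).2 s hs]
  -- convergence of the rescaled transform
  have hP : ∀ r, 0 < r → Tendsto
      (fun t => lam t * (Real.exp (-t) * φ₀ (σ t (r / lam t)))) atTop (𝓝 (aF Mstar r)) := by
    intro r hr
    have h1 : Tendsto (fun t => aF (fun z => M t (lam t * z)) r) atTop (𝓝 (aF Mstar r)) := by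
      unfold aF
      refine tendsto_integral_filter_of_dominated_convergence
        (fun y => kap (r * y) / y ^ 2) ?_ ?_ (kap_int hr) ?_
      · filter_upwards [eventually_ge_atTop 0] with t ht
        have hm : Measurable (fun z => M t (lam t * z)) :=
          (hMmono t ht).measurable.comp (measurable_const_mul _)
        exact ((kap_meas r).mul hm).aestronglyMeasurable
      · filter_upwards [eventually_ge_atTop 0] with t ht
        refine (ae_restrict_iff' measurableSet_Ioi).2 (Eventually.of_forall fun y hy => ?_)
        have hf := setint_facts (hmt t ht) (lam t * y)
        rw [← hM t ht] at hf
        rw [Real.norm_of_nonneg (mul_nonneg (kap_nn hr hy) hf.2.1)]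
        exact mul_le_of_le_one_right (kap_nn hr hy) hf.2.2
      · rw [ae_restrict_iff' measurableSet_Ioi]
        have hc : ∀ᵐ y : ℝ, ContinuousAt Mstar y := by
          rw [ae_iff]
          exact hM_mono.countable_not_continuousAt.measure_zero _
        filter_upwards [hc] with y hy hy0
        exact (hconv y hy0 hy).const_mul _
    refine h1.congr' ?_
    filter_upwards [eventually_gt_atTop 0] with t ht
    have hl := hlam_pos t ht
    rw [hlapM t ht.le _ (div_pos hr hl)]
    have h2 := aF_scale (M t) (inv_pos.2 hl) r
    rw [show r / lam t = (lam t)⁻¹ * r by rw [div_eq_inv_mul], h2, ← mul_assoc,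
      mul_inv_cancel₀ hl.ne', one_mul]
    congr 1
    ext z
    rw [div_inv_eq_mul, mul_comm]
  set a : ℝ → ℝ := aF Mstar with ha_def
  have hapos : ∀ s, 0 < s → 0 < a s := fun s hs => aF_pos hM_mono hM_nonneg hM_one hs
  have hasm : ∀ s r, 0 < s → s < r → a s < a r := fun s r hs hsr =>
    aF_strictMono hM_mono hM_nonneg hM_one hs hsr
  have hadiv : ∀ s r, 0 < s → s < r → a r / r < a s / s := fun s r hs hsr =>
    aF_div_strictAnti hM_mono hM_nonneg hM_rc hM_one hM_nontrivial hs hsr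
  have hac : ContinuousOn a (Ioi 0) := by
    refine cont_of_bounds hapos ?_ ?_
    · intro s r hs hsr
      rcases eq_or_lt_of_le hsr with h | h
      · rw [h]
      · exact (hasm s r hs h).le
    · intro s r hs hsr
      rcases eq_or_lt_of_le hsr with h | h
      · rw [h]
      · exact (hadiv s r hs h).le
  set b : ℝ → ℝ := fun r => r / a r - 1 with hb_def
  have hbsm : ∀ s r, 0 < s → s < r → b s < b r := by
    intro s r hs hsr
    have h1 := hadiv s r hs hsr
    have hr := hs.trans hsr
    rw [div_lt_div_iff₀ hr hs] at h1
    simp only [hb_def]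
    refine sub_lt_sub_right ?_ 1
    rw [div_lt_div_iff₀ (hapos s hs) (hapos r hr)]
    linarith
  have hbc : ContinuousOn b (Ioi 0) :=
    (continuousOn_id.div hac fun x hx => (hapos x hx).ne').sub continuousOn_const
  set h : ℝ → ℝ := fun s => Psi ν₀ s / s with hh_def
  have hhpos : ∀ s, 0 < s → 0 < h s := fun s hs => div_pos (hψpos s hs) hs
  have hhmono : ∀ s r, 0 < s → s ≤ r → h s ≤ h r := by
    intro s r hs hsr
    simp only [hh_def, Psi]
    rw [← integral_div, ← integral_div]
    exact integral_mono ((hgint s hs.le).div_const _)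
      ((hgint r (hs.le.trans hsr)).div_const _) fun x => gker_mono hs hsr
  have hhanti : ∀ s r, 0 < s → s ≤ r → h r / r ≤ h s / s := by
    intro s r hs hsr
    simp only [hh_def, Psi]
    rw [← integral_div, ← integral_div, ← integral_div, ← integral_div]
    refine integral_mono_ae (((hgint r (hs.le.trans hsr)).div_const _).div_const _)
      (((hgint s hs.le).div_const _).div_const _) ?_
    filter_upwards [hpos₀] with x hx
    exact gker_anti hx.le hs hsr
  have hexp0 : Tendsto (fun t : ℝ => Real.exp (-t)) atTop (𝓝 0) :=
    Real.tendsto_exp_neg_atTop_nhds_zero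
  have H1 : ∀ r, 0 < r → Tendsto
      (fun t => σ t (r / lam t) / (Real.exp t / lam t)) atTop (𝓝 (a r)) := by
    intro r hr
    have h1 := (hexp0.mul_const r).add ((hexp0.const_sub 1).mul (hP r hr))
    rw [zero_mul, zero_add, sub_zero, one_mul] at h1
    refine h1.congr' ?_
    filter_upwards [eventually_gt_atTop 0] with t ht
    have hl := hlam_pos t ht
    have g := (hσ t ht.le (r / lam t) (div_pos hr hl)).2
    have g2 : σ t (r / lam t) = r / lam t + (1 - Real.exp (-t)) * φ₀ (σ t (r / lam t)) := by
      linarith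
    generalize φ₀ (σ t (r / lam t)) = q at g2 ⊢
    rw [g2, Real.exp_neg]
    have := Real.exp_pos t
    field_simp
  have H2 : ∀ r, 0 < r → Tendsto
      (fun t => Real.exp t * h (σ t (r / lam t))) atTop (𝓝 (b r)) := by
    intro r hr
    have h1 := ((hP r hr).const_sub r).div (H1 r hr) (hapos r hr).ne'
    have e : (r - aF Mstar r) / a r = b r := by
      simp only [hb_def, ← ha_def]
      have := (hapos r hr).ne'
      field_simp
    rw [e] at h1
    refine h1.congr' ?_
    filter_upwards [eventually_gt_atTop 0] with t ht
    have hl := hlam_pos t ht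
    obtain ⟨g0, g⟩ := hσ t ht.le (r / lam t) (div_pos hr hl)
    simp only [Pi.div_apply, hh_def]
    rw [hPsi _ g0.le]
    have g2 : σ t (r / lam t) - φ₀ (σ t (r / lam t))
      = r / lam t - Real.exp (-t) * φ₀ (σ t (r / lam t)) := by
      linarith
    rw [g2]
    generalize φ₀ (σ t (r / lam t)) = q
    generalize σ t (r / lam t) = w at g0
    have := Real.exp_pos t
    field_simp
  have hbnn : ∀ s, 0 < s → 0 ≤ b s := by
    intro s hs
    refine ge_of_tendsto (H2 s hs) ?_
    filter_upwards [eventually_gt_atTop 0] with t ht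
    exact mul_nonneg (Real.exp_pos t).le
      (hhpos _ (hσ t ht.le _ (div_pos hs (hlam_pos t ht))).1).le
  have hbpos : ∀ s, 0 < s → 0 < b s := fun s hs =>
    (hbnn _ (half_pos hs)).trans_lt (hbsm _ _ (half_pos hs) (half_lt_self hs))
  obtain ⟨ρ, hρ, hrv⟩ := rv_main hhpos hhmono hhanti (h_tendsto hν₀supp hid)
    (fun s hs r _ hsr => hasm s r hs hsr) hac hapos (fun s hs r _ hsr => hbsm s r hs hsr) hbc hbpos
    (sg := fun t r => σ t (r / lam t)) (mu := fun t => Real.exp t / lam t)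
    (by
      filter_upwards [eventually_gt_atTop 0] with t ht r hr
      exact (hσ t ht.le _ (div_pos hr (hlam_pos t ht))).1)
    (by
      filter_upwards [eventually_gt_atTop 0] with t ht
      exact div_pos (Real.exp_pos t) (hlam_pos t ht))
    H1 H2
  obtain ⟨c0, hc0, htaub⟩ := taub hν₀supp hgint hψpos hρ (by
    intro v hv
    have h1 := (hrv v hv).const_mul v
    have e : v * v ^ ρ = v ^ (1 + ρ) := by rw [Real.rpow_add hv, Real.rpow_one]
    rw [e] at h1
    refine h1.congr' ?_
    filter_upwards [self_mem_nhdsWithin] with s hs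
    have hs0 : (0:ℝ) < s := hs
    have := (hψpos s hs).ne'
    simp only [hh_def]
    field_simp)
  have hinv : Tendsto (fun x : ℝ => x⁻¹) atTop (𝓝[>] 0) := tendsto_inv_atTop_nhdsGT_zero
  refine ⟨ρ, hρ, fun x => c0 * x ^ ρ * h x⁻¹, ?_, ?_, ?_⟩
  · intro x hx
    exact mul_pos (mul_pos hc0 (Real.rpow_pos_of_pos hx _)) (hhpos _ (inv_pos.2 hx))
  · intro c hc
    have h1 := ((hrv c⁻¹ (inv_pos.2 hc)).comp hinv).const_mul (c ^ ρ)
    rw [Real.inv_rpow hc.le, mul_inv_cancel₀ (Real.rpow_pos_of_pos hc ρ).ne'] at h1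
    refine h1.congr' ?_
    filter_upwards [eventually_gt_atTop 0] with x hx
    simp only [Function.comp]
    rw [Real.mul_rpow hc.le hx.le, mul_inv_rev]
    have e1 := (hhpos _ (inv_pos.2 hx)).ne'
    have e2 := (Real.rpow_pos_of_pos hx ρ).ne'
    generalize h (x⁻¹ * c⁻¹) = q1
    generalize h x⁻¹ = q2 at e1 ⊢
    generalize x ^ ρ = q3 at e2 ⊢
    field_simp
  · have h1 := (htaub.comp hinv).div_const c0
    rw [div_self hc0.ne'] at h1
    refine h1.congr' ?_
    filter_upwards [eventually_gt_atTop 0] with x hx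
    simp only [Function.comp, hh_def]
    have e3 : x ^ (1 - ρ) * (c0 * x ^ ρ * (Psi ν₀ x⁻¹ / x⁻¹)) = c0 * x ^ 2 * Psi ν₀ x⁻¹ := by
      have : x ^ (1 - ρ) * x ^ ρ = x := by
        rw [← Real.rpow_add hx]; simp
      calc _ = (x ^ (1 - ρ) * x ^ ρ) * (c0 * (Psi ν₀ x⁻¹ / x⁻¹)) := by ring
        _ = _ := by rw [this, div_inv_eq_mul]; ring
    rw [e3, one_div, inv_inv]
    have e1 := (hψpos _ (inv_pos.2 hx)).ne'
    generalize Psi ν₀ x⁻¹ = q2 at e1 ⊢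
    field_simp
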